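/- arXiv:2504.17625 — 5 statements merged into one kernel-verified Lean document; each statement's English description precedes it below -/
import Mathlib

section
/- Let D ⊆ ℂ be a simply connected domain, and let a, d : D → ℝ and b, c : D → ℂ be smooth with a > 0 and satisfying the system (ma0) on D. If b_w̄ ≡ 0 on D (i.e., b is holomorphic), then there exist holomorphic functions h and f on D such that a = e^{2Re(h)}, c_w̄ = e^{2Re(h)}·conj(f), and d_{w̄w} = e^{2Re(h)}|f|² + e^{−2Re(h)} on D. -/
open Complex
open scoped ComplexOrder

noncomputable section

/-- Wirtinger derivative `F_w = (1/2)(∂F/∂x − i ∂F/∂y)`. -/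
def wDeriv (F : ℂ → ℂ) (w : ℂ) : ℂ :=
  (fderiv ℝ F w 1 - Complex.I * fderiv ℝ F w Complex.I) / 2

/-- Wirtinger derivative `F_w̄ = (1/2)(∂F/∂x + i ∂F/∂y)`. -/
def wBarDeriv (F : ℂ → ℂ) (w : ℂ) : ℂ :=
  (fderiv ℝ F w 1 + Complex.I * fderiv ℝ F w Complex.I) / 2

/-- The mixed second Wirtinger derivative `F_{w̄ w}`. -/
def wBarWDeriv (F : ℂ → ℂ) (w : ℂ) : ℂ := wDeriv (wBarDeriv F) w

/-- `u_z`, the Wirtinger derivative in the first variable. -/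
def pzDeriv (u : ℂ × ℂ → ℂ) (p : ℂ × ℂ) : ℂ :=
  (fderiv ℝ u p (1, 0) - Complex.I * fderiv ℝ u p (Complex.I, 0)) / 2

/-- `u_z̄`, the conjugate Wirtinger derivative in the first variable. -/
def pzBarDeriv (u : ℂ × ℂ → ℂ) (p : ℂ × ℂ) : ℂ :=
  (fderiv ℝ u p (1, 0) + Complex.I * fderiv ℝ u p (Complex.I, 0)) / 2

/-- `u_w`, the Wirtinger derivative in the second variable. -/
def pwDeriv (u : ℂ × ℂ → ℂ) (p : ℂ × ℂ) : ℂ :=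
  (fderiv ℝ u p (0, 1) - Complex.I * fderiv ℝ u p (0, Complex.I)) / 2

/-- `u_w̄`, the conjugate Wirtinger derivative in the second variable. -/
def pwBarDeriv (u : ℂ × ℂ → ℂ) (p : ℂ × ℂ) : ℂ :=
  (fderiv ℝ u p (0, 1) + Complex.I * fderiv ℝ u p (0, Complex.I)) / 2

/-- The complex Hessian `[[u_{z z̄}, u_{z w̄}], [u_{w z̄}, u_{w w̄}]]` of a real-valued
function on `ℂ × ℂ`. -/
def complexHessian (u : ℂ × ℂ → ℝ) (p : ℂ × ℂ) : Matrix (Fin 2) (Fin 2) ℂ :=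
  !![pzDeriv (pzBarDeriv fun q => (u q : ℂ)) p, pzDeriv (pwBarDeriv fun q => (u q : ℂ)) p;
     pwDeriv (pzBarDeriv fun q => (u q : ℂ)) p, pwDeriv (pwBarDeriv fun q => (u q : ℂ)) p]

/-- `det (∂ ∂̄ u) = u_{z z̄} u_{w w̄} − u_{z w̄} u_{w z̄}`. -/
def MAdet (u : ℂ × ℂ → ℝ) (p : ℂ × ℂ) : ℂ := (complexHessian u p).det

/-- `u` is strictly plurisubharmonic at `p` iff its complex Hessian is positive definite. -/
def StrictPSHAt (u : ℂ × ℂ → ℝ) (p : ℂ × ℂ) : Prop := (complexHessian u p).PosDef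

/-- The special quadric form (smae):
`u(z,w) = a(w)|z|² + b(w)z² + conj(b(w)z²) + c(w)z + conj(c(w)z) + d(w)`. -/
def smae (a d : ℂ → ℝ) (b c : ℂ → ℂ) : ℂ × ℂ → ℝ := fun p =>
  a p.2 * Complex.normSq p.1 + (b p.2 * p.1 ^ 2 + (starRingEnd ℂ) (b p.2 * p.1 ^ 2)
    + c p.2 * p.1 + (starRingEnd ℂ) (c p.2 * p.1)).re + d p.2

/-- The system (ma0) on a set `D ⊆ ℂ`:
`a a_{w̄w} = |a_w|² + 4|b_w̄|²`, `a b_{w̄w} = 2 a_w b_w̄`,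
`a c_{w̄w} = a_w c_w̄ + 2 b_w̄ conj(c_w)`, `a d_{w̄w} = |c_w̄|² + 1`. -/
def ma0sys (a d : ℂ → ℝ) (b c : ℂ → ℂ) (D : Set ℂ) : Prop :=
  ∀ w ∈ D,
    (a w : ℂ) * wBarWDeriv (fun v => (a v : ℂ)) w
        = (Complex.normSq (wDeriv (fun v => (a v : ℂ)) w) : ℂ)
          + 4 * (Complex.normSq (wBarDeriv b w) : ℂ) ∧
    (a w : ℂ) * wBarWDeriv b w = 2 * wDeriv (fun v => (a v : ℂ)) w * wBarDeriv b w ∧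
    (a w : ℂ) * wBarWDeriv c w
        = wDeriv (fun v => (a v : ℂ)) w * wBarDeriv c w
          + 2 * wBarDeriv b w * (starRingEnd ℂ) (wDeriv c w) ∧
    (a w : ℂ) * wBarWDeriv (fun v => (d v : ℂ)) w = (Complex.normSq (wBarDeriv c w) : ℂ) + 1


/-- The complex numbers with the discrete topology. -/
def DiscC : Type := ℂ

instance instTopDiscC : TopologicalSpace DiscC := ⊥
instance instDiscDiscC : DiscreteTopology DiscC := ⟨rfl⟩

open Topology in
lemma exists_primitive_sc (D : Set ℂ) (hDo : IsOpen D) (hDsc : SimplyConnectedSpace ↥D)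
    (g : ℂ → ℂ) (hg : DifferentiableOn ℂ g D) :
    ∃ h : ℂ → ℂ, ∀ z ∈ D, HasDerivAt h (g z) z := by
  classical
  have hr : ∀ x : D, ∃ r > 0, Metric.ball (x : ℂ) r ⊆ D := fun x =>
    Metric.isOpen_iff.mp hDo x x.2
  choose r hr0 hrD using hr
  have hP : ∀ x : D, ∃ P : ℂ → ℂ, ∀ z ∈ Metric.ball (x : ℂ) (r x), HasDerivAt P (g z) z :=
    fun x => (hg.mono (hrD x)).isExactOn_ball
  choose P hP using hP
  have hk : ∀ i j : D, ∃ k : ℂ, ∀ x ∈ Metric.ball (i : ℂ) (r i) ∩ Metric.ball (j : ℂ) (r j),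
      P i x - P j x = k := by
    intro i j
    apply (Metric.isOpen_ball.inter Metric.isOpen_ball).exists_is_const_of_deriv_eq_zero (𝕜 := ℂ)
    · exact ((convex_ball _ _).inter (convex_ball _ _)).isPreconnected
    · intro x hx
      exact ((hP i x hx.1).sub (hP j x hx.2)).differentiableAt.differentiableWithinAt
    · intro x hx
      have := ((hP i x hx.1).sub (hP j x hx.2)).deriv
      rw [sub_self] at this
      exact this
  choose k hk using hk
  let Z : FiberBundleCore D D DiscC :=
    { baseSet := fun i => {x : D | (x : ℂ) ∈ Metric.ball (i : ℂ) (r i)}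
      isOpen_baseSet := fun i => Metric.isOpen_ball.preimage continuous_subtype_val
      indexAt := id
      mem_baseSet_at := fun x => Metric.mem_ball_self (hr0 x)
      coordChange := fun i j x v => (show ℂ from v) + (P i x - P j x)
      coordChange_self := by
        intro i x hx v
        show (show ℂ from v) + (P i x - P i x) = (show ℂ from v)
        rw [sub_self]
        exact add_zero (show ℂ from v)
      continuousOn_coordChange := by
        intro i j
        have : Continuous (fun p : D × DiscC =>
            (show DiscC from ((show ℂ from p.2) + k i j))) :=
          (continuous_of_discreteTopology
            (f := fun v : DiscC => (show DiscC from ((show ℂ from v) + k i j)))).comp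
            continuous_snd
        refine this.continuousOn.congr ?_
        rintro ⟨x, v⟩ ⟨hx, -⟩
        show (show ℂ from v) + (P i x - P j x) = (show ℂ from v) + k i j
        rw [hk i j x hx]
      coordChange_comp := by
        intro i j l x hx v
        show ((show ℂ from v) + (P i x - P j x)) + (P j x - P l x)
          = (show ℂ from v) + (P i x - P l x)
        ring }
  have cov : IsCoveringMap (Bundle.TotalSpace.proj : Bundle.TotalSpace DiscC Z.Fiber → D) :=
    FiberBundle.isCoveringMap
  have : LocallyPathConnectedSpace D := hDo.locallyPathConnectedSpace
  obtain ⟨x0⟩ : Nonempty D := inferInstance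
  obtain ⟨σ, ⟨-, hσ⟩, -⟩ := cov.existsUnique_continuousMap_lifts (ContinuousMap.id D) x0
    ⟨x0, (show DiscC from (0 : ℂ))⟩ rfl
  have hσ' : ∀ x, (σ x).proj = x := fun x => congrFun hσ x
  let v : D → ℂ := fun x => (σ x).snd
  let h : ℂ → ℂ := fun z => if hz : z ∈ D then P ⟨z, hz⟩ z + v ⟨z, hz⟩ else 0
  refine ⟨h, fun z hz => ?_⟩
  let i : D := ⟨z, hz⟩
  have hcont : ContinuousAt (fun y : D => ((Z.localTriv i) (σ y)).2) i := by
    have h1 : ContinuousAt (Z.localTriv i) (σ i) := by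
      apply (Z.localTriv i).continuousAt
      rw [(Z.localTriv i).mem_source]
      show ((σ i).proj : ℂ) ∈ Metric.ball (i : ℂ) (r i)
      rw [hσ']
      exact Metric.mem_ball_self (hr0 i)
    exact continuousAt_snd.comp (ContinuousAt.comp (f := σ) h1 σ.continuous.continuousAt)
  have hev : ∀ᶠ y in 𝓝 i, ((Z.localTriv i) (σ y)).2 = ((Z.localTriv i) (σ i)).2 :=
    hcont.eventually (p := fun t => t = ((Z.localTriv i) (σ i)).2)
      (by rw [nhds_discrete]; exact rfl)
  have hval : ∀ y : D, (show ℂ from ((Z.localTriv i) (σ y)).2) = v y + (P y y - P i y) := by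
    intro y
    have : (show ℂ from ((Z.localTriv i) (σ y)).2)
      = v y + (P (σ y).proj (σ y).proj - P i (σ y).proj) := rfl
    rw [this, hσ']
  have hev2 : ∀ᶠ y in 𝓝 z, h y = P i y + v i := by
    have : ∀ᶠ y in 𝓝 z, ∀ hy : y ∈ D, v ⟨y, hy⟩ + (P ⟨y, hy⟩ y - P i y) = v i := by
      rw [nhds_subtype_eq_comap, Filter.eventually_comap] at hev
      filter_upwards [hev] with y hy hyD
      have := hy ⟨y, hyD⟩ rfl
      have h2 : (show ℂ from ((Z.localTriv i) (σ ⟨y, hyD⟩)).2)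
        = (show ℂ from ((Z.localTriv i) (σ i)).2) := this
      rw [hval, hval] at h2
      simpa using h2
    filter_upwards [this, hDo.mem_nhds hz] with y hy hyD
    simp only [h, hyD, dif_pos]
    rw [← hy hyD]; ring
  exact ((hP i z (Metric.mem_ball_self (hr0 i))).add_const (v i)).congr_of_eventuallyEq hev2

lemma conj_quot_holo {N : ℂ → ℂ} {a : ℂ → ℝ} {w : ℂ} (hN : DifferentiableAt ℝ N w)
    (ha : DifferentiableAt ℝ a w) (haw : a w ≠ 0)
    (h : (a w : ℂ) * wDeriv N w = wDeriv (fun v => (a v : ℂ)) w * N w) :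
    DifferentiableAt ℂ (fun v => (starRingEnd ℂ) (N v / (a v : ℂ))) w := by
  have hA : HasFDerivAt (fun v => (a v : ℂ)) (Complex.ofRealCLM.comp (fderiv ℝ a w)) w :=
    Complex.ofRealCLM.hasFDerivAt.comp w ha.hasFDerivAt
  have hne : (a w : ℂ) ≠ 0 := by exact_mod_cast haw
  have hQ : DifferentiableAt ℝ (fun v => N v / (a v : ℂ)) w := by
    have h1 : DifferentiableAt ℝ (fun z : ℂ => z⁻¹) (a w : ℂ) :=
      (differentiableAt_inv (𝕜 := ℂ) hne).restrictScalars ℝ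
    have h2 : DifferentiableAt ℝ (fun v => ((a v : ℂ))⁻¹) w :=
      DifferentiableAt.comp (g := fun z : ℂ => z⁻¹) w h1 hA.differentiableAt
    simp only [div_eq_mul_inv]
    exact hN.mul h2
  have hM : (fun v => (N v / (a v : ℂ)) * (a v : ℂ)) =ᶠ[nhds w] N := by
    have : ∀ᶠ v in nhds w, a v ≠ 0 := ha.continuousAt.eventually_ne haw
    filter_upwards [this] with v hv
    have : (a v : ℂ) ≠ 0 := by exact_mod_cast hv
    field_simp
  have hN' : fderiv ℝ N w = _ :=
    ((hQ.hasFDerivAt.mul hA).congr_of_eventuallyEq hM.symm).fderiv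
  have hC := (Complex.conjCLE.toContinuousLinearMap.hasFDerivAt.comp w hQ.hasFDerivAt)
  have hC' : HasFDerivAt (fun v => (starRingEnd ℂ) (N v / (a v : ℂ))) _ w := hC
  rw [differentiableAt_complex_iff_differentiableAt_real]
  refine ⟨hC'.differentiableAt, ?_⟩
  rw [hC'.fderiv]
  unfold wDeriv at h
  rw [hN', hA.fderiv] at h
  simp at h ⊢
  set X := fderiv ℝ (fun v => N v / (a v : ℂ)) w 1
  set Y := fderiv ℝ (fun v => N v / (a v : ℂ)) w I
  have hXY : X - I * Y = 0 := by
    have h3 : (a w : ℂ) * (a w : ℂ) * (X - I * Y) = 0 := by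
      field_simp at h
      linear_combination h
    simpa [hne] using h3
  have hX : Y = - I * X := by
    linear_combination I * hXY + Y * I_mul_I
  rw [hX]; simp

theorem stmt2_aux (D : Set ℂ) (hDo : IsOpen D) (hDc : IsConnected D)
    (hDsc : SimplyConnectedSpace ↥D)
    (a d : ℂ → ℝ) (b c : ℂ → ℂ)
    (ha : ContDiffOn ℝ (⊤ : ℕ∞) a D)
    (hc : ContDiffOn ℝ (⊤ : ℕ∞) c D)
    (hapos : ∀ w ∈ D, 0 < a w)
    (hma0 : ma0sys a d b c D)
    (hbbar : ∀ w ∈ D, wBarDeriv b w = 0) :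
    ∃ h f : ℂ → ℂ, DifferentiableOn ℂ h D ∧ DifferentiableOn ℂ f D ∧
      ∀ w ∈ D,
        a w = Real.exp (2 * (h w).re) ∧
        wBarDeriv c w = (Real.exp (2 * (h w).re) : ℂ) * (starRingEnd ℂ) (f w) ∧
        wBarWDeriv (fun v => (d v : ℂ)) w
          = ((Real.exp (2 * (h w).re) * Complex.normSq (f w)
              + Real.exp (-(2 * (h w).re)) : ℝ) : ℂ) := by
  have hane : ∀ w ∈ D, (a w : ℂ) ≠ 0 := fun w hw => by exact_mod_cast (hapos w hw).ne'
  have hsm : ∀ F : ℂ → ℂ, ContDiffOn ℝ (⊤ : ℕ∞) F D → ∀ w ∈ D,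
      DifferentiableAt ℝ (wBarDeriv F) w := by
    intro F hF w hw
    have h1 : ContDiffAt ℝ 2 F w := ((hF w hw).contDiffAt (hDo.mem_nhds hw)).of_le (by
      exact WithTop.coe_le_coe.2 (le_top : (2 : ℕ∞) ≤ ⊤))
    have h2 : DifferentiableAt ℝ (fderiv ℝ F) w :=
      (h1.fderiv_right (m := 1) (by norm_num)).differentiableAt (by norm_num)
    unfold wBarDeriv
    fun_prop
  have had : ∀ w ∈ D, DifferentiableAt ℝ a w := fun w hw =>
    ((ha w hw).contDiffAt (hDo.mem_nhds hw)).differentiableAt (by simp)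
  have haC : ContDiffOn ℝ (⊤ : ℕ∞) (fun v => (a v : ℂ)) D :=
    Complex.ofRealCLM.contDiff.comp_contDiffOn ha
  have hfA : ∀ w ∈ D, fderiv ℝ (fun v => (a v : ℂ)) w = Complex.ofRealCLM.comp (fderiv ℝ a w) :=
    fun w hw => (Complex.ofRealCLM.hasFDerivAt.comp w (had w hw).hasFDerivAt).fderiv
  set g : ℂ → ℂ := fun w =>
    (starRingEnd ℂ) (wBarDeriv (fun v => (a v : ℂ)) w / (a w : ℂ)) with hgdef
  set f : ℂ → ℂ := fun w => (starRingEnd ℂ) (wBarDeriv c w / (a w : ℂ)) with hfdef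
  have hg : DifferentiableOn ℂ g D := by
    intro w hw
    refine (conj_quot_holo (hsm _ haC w hw) (had w hw) (hapos w hw).ne' ?_).differentiableWithinAt
    have h1 := (hma0 w hw).1
    rw [hbbar w hw] at h1
    have h2 : wBarDeriv (fun v => (a v : ℂ)) w
        = (starRingEnd ℂ) (wDeriv (fun v => (a v : ℂ)) w) := by
      unfold wBarDeriv wDeriv
      rw [hfA w hw]
      simp [map_ofNat]
    rw [h2, Complex.mul_conj]
    simpa [wBarWDeriv] using h1
  have hf : DifferentiableOn ℂ f D := by
    intro w hw
    refine (conj_quot_holo (hsm _ hc w hw) (had w hw) (hapos w hw).ne' ?_).differentiableWithinAt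
    have h1 := (hma0 w hw).2.2.1
    rw [hbbar w hw] at h1
    simpa [wBarWDeriv] using h1
  obtain ⟨h, hh⟩ := exists_primitive_sc D hDo hDsc g hg
  have hre : ∀ w ∈ D, HasFDerivAt (fun z => (h z).re)
      (Complex.reCLM.comp ((ContinuousLinearMap.toSpanSingleton ℂ (g w)).restrictScalars ℝ)) w :=
    fun w hw => Complex.reCLM.hasFDerivAt.comp w ((hh w hw).hasFDerivAt.restrictScalars ℝ)
  have hlog : ∀ w ∈ D, HasFDerivAt (fun z => Real.log (a z) / 2)
      ((2 : ℝ)⁻¹ • ((a w)⁻¹ • fderiv ℝ a w)) w := by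
    intro w hw
    have := ((had w hw).hasFDerivAt.log (hapos w hw).ne').const_smul (2 : ℝ)⁻¹
    refine this.congr_of_eventuallyEq (Filter.Eventually.of_forall fun z => ?_)
    simp; ring
  obtain ⟨k, hk⟩ : ∃ k, D.EqOn (fun z => Real.log (a z) / 2) (fun z => (h z).re + k) := by
    apply hDo.exists_eq_add_of_fderiv_eq hDc.isPreconnected (𝕜 := ℝ)
    · exact fun w hw => (hlog w hw).differentiableAt.differentiableWithinAt
    · exact fun w hw => (hre w hw).differentiableAt.differentiableWithinAt
    · intro w hw
      rw [(hlog w hw).fderiv, (hre w hw).fderiv]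
      have hg' : g w = (fderiv ℝ a w 1 - I * fderiv ℝ a w I) / (2 * a w) := by
        simp only [hgdef, wBarDeriv]
        rw [hfA w hw]
        have := hane w hw
        simp [map_ofNat]
        field_simp
        ring
      have hg2 : g w = ((fderiv ℝ a w 1 / (2 * a w) : ℝ) : ℂ)
          + ((-(fderiv ℝ a w I / (2 * a w)) : ℝ) : ℂ) * I := by
        rw [hg']; push_cast; ring
      ext v
      have hv : fderiv ℝ a w v = v.re * fderiv ℝ a w 1 + v.im * fderiv ℝ a w I := by
        conv_lhs => rw [show v = v.re • (1 : ℂ) + v.im • (I : ℂ) by simp]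
        rw [map_add, map_smul, map_smul]; simp
      have := (hapos w hw).ne'
      simp only [smul_apply, ContinuousLinearMap.comp_apply,
        Complex.add_re, Complex.add_im, Complex.mul_re, Complex.mul_im, Complex.ofReal_re,
        Complex.ofReal_im, Complex.I_re, Complex.I_im,
        ContinuousLinearMap.coe_restrictScalars', ContinuousLinearMap.toSpanSingleton_apply,
        Complex.reCLM_apply, smul_eq_mul, hv, hg2]
      field_simp
      ring
  have hexp : ∀ w ∈ D, Real.exp (2 * (h w + (k : ℂ)).re) = a w := by
    intro w hw
    have h1 : Real.log (a w) / 2 = (h w).re + k := hk hw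
    have : 2 * (h w + (k : ℂ)).re = Real.log (a w) := by
      simp; linarith
    rw [this, Real.exp_log (hapos w hw)]
  refine ⟨fun z => h z + (k : ℂ), f, fun w hw =>
    ((hh w hw).add_const _).differentiableAt.differentiableWithinAt, hf, fun w hw => ?_⟩
  have hne := hane w hw
  have hcf : wBarDeriv c w = (a w : ℂ) * (starRingEnd ℂ) (f w) := by
    simp only [hfdef, Complex.conj_conj]
    field_simp
  refine ⟨(hexp w hw).symm, ?_, ?_⟩
  · rw [hexp w hw]; exact hcf
  · rw [Real.exp_neg, hexp w hw]
    have h4 := (hma0 w hw).2.2.2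
    rw [hcf] at h4
    apply mul_left_cancel₀ hne
    rw [h4]
    simp [Complex.normSq_mul]
    field_simp

/-- if `(a,b,c,d)` solves (ma0) on a simply connected domain `D` and
`b_w̄ ≡ 0` on `D`, then `a = e^{2Re h}`, `c_w̄ = e^{2Re h} conj f`, and
`d_{w̄w} = e^{2Re h}|f|² + e^{−2Re h}` for some holomorphic `h, f` on `D`. -/
theorem stmt2 (D : Set ℂ) (hDo : IsOpen D) (hDc : IsConnected D)
    (hDsc : SimplyConnectedSpace ↥D)
    (a d : ℂ → ℝ) (b c : ℂ → ℂ)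
    (ha : ContDiffOn ℝ (⊤ : ℕ∞) a D) (hd : ContDiffOn ℝ (⊤ : ℕ∞) d D)
    (hb : ContDiffOn ℝ (⊤ : ℕ∞) b D) (hc : ContDiffOn ℝ (⊤ : ℕ∞) c D)
    (hapos : ∀ w ∈ D, 0 < a w)
    (hma0 : ma0sys a d b c D)
    (hbbar : ∀ w ∈ D, wBarDeriv b w = 0) :
    ∃ h f : ℂ → ℂ, DifferentiableOn ℂ h D ∧ DifferentiableOn ℂ f D ∧
      ∀ w ∈ D,
        a w = Real.exp (2 * (h w).re) ∧
        wBarDeriv c w = (Real.exp (2 * (h w).re) : ℂ) * (starRingEnd ℂ) (f w) ∧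
        wBarWDeriv (fun v => (d v : ℂ)) w
          = ((Real.exp (2 * (h w).re) * Complex.normSq (f w)
              + Real.exp (-(2 * (h w).re)) : ℝ) : ℂ) := by
  exact stmt2_aux D hDo hDc hDsc a d b c ha hc hapos hma0 hbbar
end
end

section
/- Fix R > 0 and define u on ℂ × D_R by u(z,w) = R|z|²/(R² − |w|²) + w̄ z²/(2(R² − |w|²)) + w z̄²/(2(R² − |w|²)) + R|w|² − |w|⁴/(4R). Then u is smooth and strictly plurisubharmonic on ℂ × D_R and satisfies det(∂∂̄u) = 1 everywhere on ℂ × D_R. -/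
open Complex
open scoped ComplexOrder

noncomputable section

/-- the real-linear form `a dz + b dz̄ + c dw + d dw̄` -/
def wL (a b c d : ℂ) : ℂ × ℂ →L[ℝ] ℂ :=
  a • ContinuousLinearMap.fst ℝ ℂ ℂ
    + b • ((Complex.conjCLE : ℂ →L[ℝ] ℂ).comp (ContinuousLinearMap.fst ℝ ℂ ℂ))
    + c • ContinuousLinearMap.snd ℝ ℂ ℂ
    + d • ((Complex.conjCLE : ℂ →L[ℝ] ℂ).comp (ContinuousLinearMap.snd ℝ ℂ ℂ))

theorem wL_apply (a b c d : ℂ) (v : ℂ × ℂ) :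
    wL a b c d v = a * v.1 + b * (starRingEnd ℂ) v.1 + c * v.2 + d * (starRingEnd ℂ) v.2 := by
  simp [wL]

def HW (F : ℂ × ℂ → ℂ) (p : ℂ × ℂ) (a b c d : ℂ) : Prop := HasFDerivAt F (wL a b c d) p

theorem I_aux (a b : ℂ) : (a + b - I * (a * I - b * I)) / 2 = a := by
  linear_combination (-(a - b) / 2) * I_mul_I

theorem I_aux' (a b : ℂ) : (a + b + I * (a * I - b * I)) / 2 = b := by
  linear_combination ((a - b) / 2) * I_mul_I

namespace HW
variable {F G : ℂ × ℂ → ℂ} {p : ℂ × ℂ} {a b c d a' b' c' d' : ℂ}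

theorem pz (h : HW F p a b c d) : pzDeriv F p = a := by
  unfold HW at h
  rw [pzDeriv, h.fderiv, wL_apply, wL_apply]
  simpa [sub_eq_add_neg] using I_aux a b
theorem pzb (h : HW F p a b c d) : pzBarDeriv F p = b := by
  unfold HW at h
  rw [pzBarDeriv, h.fderiv, wL_apply, wL_apply]
  simpa [sub_eq_add_neg] using I_aux' a b
theorem pw (h : HW F p a b c d) : pwDeriv F p = c := by
  unfold HW at h
  rw [pwDeriv, h.fderiv, wL_apply, wL_apply]
  simpa [sub_eq_add_neg] using I_aux c d
theorem pwb (h : HW F p a b c d) : pwBarDeriv F p = d := by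
  unfold HW at h
  rw [pwBarDeriv, h.fderiv, wL_apply, wL_apply]
  simpa [sub_eq_add_neg] using I_aux' c d

theorem const (k : ℂ) : HW (fun _ => k) p 0 0 0 0 := by
  refine HasFDerivAt.congr_fderiv (hasFDerivAt_const (𝕜 := ℝ) k p) ?_
  refine ContinuousLinearMap.ext fun v => ?_
  simp [wL_apply]
theorem z : HW (fun q => q.1) p 1 0 0 0 := by
  refine HasFDerivAt.congr_fderiv (hasFDerivAt_fst (𝕜 := ℝ) (p := p)) ?_
  refine ContinuousLinearMap.ext fun v => ?_
  simp [wL_apply]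
theorem w : HW (fun q => q.2) p 0 0 1 0 := by
  refine HasFDerivAt.congr_fderiv (hasFDerivAt_snd (𝕜 := ℝ) (p := p)) ?_
  refine ContinuousLinearMap.ext fun v => ?_
  simp [wL_apply]
theorem zb : HW (fun q => (starRingEnd ℂ) q.1) p 0 1 0 0 := by
  refine HasFDerivAt.congr_fderiv (((Complex.conjCLE : ℂ →L[ℝ] ℂ).comp (ContinuousLinearMap.fst ℝ ℂ ℂ)).hasFDerivAt (x := p)) ?_
  refine ContinuousLinearMap.ext fun v => ?_
  simp [wL_apply]
theorem wb : HW (fun q => (starRingEnd ℂ) q.2) p 0 0 0 1 := by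
  refine HasFDerivAt.congr_fderiv (((Complex.conjCLE : ℂ →L[ℝ] ℂ).comp (ContinuousLinearMap.snd ℝ ℂ ℂ)).hasFDerivAt (x := p)) ?_
  refine ContinuousLinearMap.ext fun v => ?_
  simp [wL_apply]
theorem add (h : HW F p a b c d) (h' : HW G p a' b' c' d') :
    HW (fun q => F q + G q) p (a + a') (b + b') (c + c') (d + d') := by
  refine HasFDerivAt.congr_fderiv (HasFDerivAt.add (𝕜 := ℝ) h h') ?_
  refine ContinuousLinearMap.ext fun v => ?_
  simp only [wL_apply, ContinuousLinearMap.add_apply]; ring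
theorem sub (h : HW F p a b c d) (h' : HW G p a' b' c' d') :
    HW (fun q => F q - G q) p (a - a') (b - b') (c - c') (d - d') := by
  refine HasFDerivAt.congr_fderiv (HasFDerivAt.sub (𝕜 := ℝ) h h') ?_
  refine ContinuousLinearMap.ext fun v => ?_
  simp only [wL_apply, ContinuousLinearMap.sub_apply]; ring
theorem mul (h : HW F p a b c d) (h' : HW G p a' b' c' d') :
    HW (fun q => F q * G q) p (F p * a' + G p * a) (F p * b' + G p * b)
      (F p * c' + G p * c) (F p * d' + G p * d) := by
  refine HasFDerivAt.congr_fderiv (HasFDerivAt.mul (𝕜 := ℝ) h h') ?_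
  refine ContinuousLinearMap.ext fun v => ?_
  simp only [wL_apply, ContinuousLinearMap.add_apply, ContinuousLinearMap.smul_apply, smul_eq_mul]
  ring
theorem inv (h : HW F p a b c d) (h0 : F p ≠ 0) :
    HW (fun q => (F q)⁻¹) p (-(F p ^ 2)⁻¹ * a) (-(F p ^ 2)⁻¹ * b)
      (-(F p ^ 2)⁻¹ * c) (-(F p ^ 2)⁻¹ * d) := by
  unfold HW at h
  have := ((hasDerivAt_inv h0).hasFDerivAt.restrictScalars ℝ).comp p h
  refine HasFDerivAt.congr_fderiv this ?_
  refine ContinuousLinearMap.ext fun v => ?_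
  simp [wL_apply]
  ring
theorem congr (h : HW F p a b c d) (ha : a = a') (hb : b = b') (hc : c = c') (hd : d = d') :
    HW F p a' b' c' d' := by subst ha hb hc hd; exact h
theorem ex1 (h : HW F p a b c d) (hb : b' = b) (hd : d' = d) :
    ∃ a c, HW F p a b' c d' := ⟨a, c, h.congr rfl hb.symm rfl hd.symm⟩
theorem ex2 (h : HW F p a b c d) (ha : a' = a) (hc : c' = c) :
    ∃ b d, HW F p a' b c' d := ⟨b, d, h.congr ha.symm rfl hc.symm rfl⟩
end HW

def Sf (R : ℝ) (q : ℂ × ℂ) : ℂ := (R : ℂ) * R - q.2 * (starRingEnd ℂ) q.2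
def Qf (R : ℝ) (q : ℂ × ℂ) : ℂ := R * q.1 + q.2 * (starRingEnd ℂ) q.1
def Uf (R : ℝ) (q : ℂ × ℂ) : ℂ :=
  ((R : ℂ) * (q.1 * (starRingEnd ℂ) q.1)
    + (1 / 2) * ((starRingEnd ℂ) q.2 * (q.1 * q.1) + q.2 * ((starRingEnd ℂ) q.1 * (starRingEnd ℂ) q.1)))
      * (Sf R q)⁻¹
    + (R * (q.2 * (starRingEnd ℂ) q.2)
      - (1 / (4 * R)) * ((q.2 * (starRingEnd ℂ) q.2) * (q.2 * (starRingEnd ℂ) q.2)))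
def Wf (R : ℝ) (q : ℂ × ℂ) : ℂ :=
  (1 / 2) * ((Qf R q * (Sf R q)⁻¹) * (Qf R q * (Sf R q)⁻¹))
    + (R * q.2 - (1 / (2 * R)) * (q.2 * (q.2 * (starRingEnd ℂ) q.2)))

theorem hS (R : ℝ) (p : ℂ × ℂ) :
    HW (Sf R) p 0 0 (-(starRingEnd ℂ) p.2) (-p.2) := by
  have := (HW.const (p := p) ((R : ℂ) * R)).sub (HW.w.mul HW.wb)
  exact HW.congr this (by simp) (by simp) (by simp) (by simp)
theorem hQ (R : ℝ) (p : ℂ × ℂ) :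
    HW (Qf R) p R p.2 ((starRingEnd ℂ) p.1) 0 := by
  have := ((HW.const (p := p) (R : ℂ)).mul HW.z).add (HW.w.mul HW.zb)
  exact HW.congr this (by simp) (by simp) (by simp) (by simp)

theorem hSR (R : ℝ) (p : ℂ × ℂ) : Sf R p = ((R ^ 2 - normSq p.2 : ℝ) : ℂ) := by
  simp [Sf, mul_conj, pow_two]

theorem u_eq (R : ℝ) (q : ℂ × ℂ) :
    (((R * Complex.normSq q.1 / (R ^ 2 - Complex.normSq q.2)
        + (((starRingEnd ℂ) q.2 * q.1 ^ 2) / (2 * ((R ^ 2 - Complex.normSq q.2 : ℝ) : ℂ))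
            + (q.2 * ((starRingEnd ℂ) q.1) ^ 2)
              / (2 * ((R ^ 2 - Complex.normSq q.2 : ℝ) : ℂ))).re
        + R * Complex.normSq q.2 - Complex.normSq q.2 ^ 2 / (4 * R)) : ℝ) : ℂ) = Uf R q := by
  have hre : ∀ x : ℂ, (starRingEnd ℂ) x = x → ((x.re : ℝ) : ℂ) = x := fun x hx =>
    Complex.conj_eq_iff_re.mp hx
  rw [ofReal_sub, ofReal_add, ofReal_add, hre]
  · rw [Uf, hSR]
    generalize R ^ 2 - normSq q.2 = s
    push_cast
    rw [← mul_conj, ← mul_conj]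
    simp only [div_eq_mul_inv, mul_inv]
    ring
  · simp only [map_add, map_div₀, map_mul, map_pow, conj_conj, conj_ofReal, map_ofNat]
    ring

theorem hU1 (R : ℝ) (hR : 0 < R) (p : ℂ × ℂ) (h0 : Sf R p ≠ 0) :
    ∃ a c, HW (Uf R) p a (Qf R p * (Sf R p)⁻¹) c (Wf R p) := by
  have hRc : (R : ℂ) ≠ 0 := by exact_mod_cast hR.ne'
  have zb := HW.zb (p := p)
  have z := HW.z (p := p)
  have w := HW.w (p := p)
  have wb := HW.wb (p := p)
  have := ((((HW.const (R : ℂ)).mul (z.mul zb)).add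
    ((HW.const (1 / 2)).mul ((wb.mul (z.mul z)).add (w.mul (zb.mul zb))))).mul
      ((hS R p).inv h0)).add
      (((HW.const (R : ℂ)).mul (w.mul wb)).sub ((HW.const (1 / (4 * (R : ℂ)))).mul
        ((w.mul wb).mul (w.mul wb))))
  refine HW.ex1 this ?_ ?_
  · rw [Qf]; ring
  · have hs : (R : ℂ) * R = Sf R p + p.2 * (starRingEnd ℂ) p.2 := by rw [Sf]; ring
    rw [Wf, Qf]
    generalize Sf R p = s at *
    field_simp
    linear_combination (4 * R * p.1 ^ 2) * hs

theorem hZb (R : ℝ) (p : ℂ × ℂ) (h0 : Sf R p ≠ 0) :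
    ∃ b d, HW (fun q => Qf R q * (Sf R q)⁻¹) p (R / Sf R p) b
      (R * (starRingEnd ℂ) (Qf R p) / Sf R p ^ 2) d := by
  refine HW.ex2 ((hQ R p).mul ((hS R p).inv h0)) ?_ ?_
  · field_simp; ring
  · have hs : (R : ℂ) * R = Sf R p + p.2 * (starRingEnd ℂ) p.2 := by rw [Sf]; ring
    simp only [Qf, map_add, map_mul, conj_conj, conj_ofReal]
    generalize Sf R p = s at *
    field_simp
    linear_combination ((starRingEnd ℂ) p.1) * hs

theorem hWb (R : ℝ) (hR : 0 < R) (p : ℂ × ℂ) (h0 : Sf R p ≠ 0) :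
    ∃ b d, HW (Wf R) p (R * Qf R p / Sf R p ^ 2) b
      (R * (Qf R p * (starRingEnd ℂ) (Qf R p)) / Sf R p ^ 3 + Sf R p / R) d := by
  have hRc : (R : ℂ) ≠ 0 := by exact_mod_cast hR.ne'
  obtain ⟨b, d, h⟩ := hZb R p h0
  have w := HW.w (p := p)
  have wb := HW.wb (p := p)
  refine HW.ex2 (((HW.const (1 / 2)).mul (h.mul h)).add
    (((HW.const (R : ℂ)).mul w).sub ((HW.const (1 / (2 * (R : ℂ)))).mul (w.mul (w.mul wb))))) ?_ ?_
  · field_simp; ring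
  · have hs : Sf R p / R = R - (1 / R) * (p.2 * (starRingEnd ℂ) p.2) := by
      rw [Sf]; field_simp
    rw [hs]
    field_simp
    ring

theorem hess (R : ℝ) (hR : 0 < R) (u : ℂ × ℂ → ℝ) (hu : ∀ q, (u q : ℂ) = Uf R q)
    (p : ℂ × ℂ) (h0 : Sf R p ≠ 0) :
    complexHessian u p = !![R / Sf R p, R * Qf R p / Sf R p ^ 2;
      R * (starRingEnd ℂ) (Qf R p) / Sf R p ^ 2,
      R * (Qf R p * (starRingEnd ℂ) (Qf R p)) / Sf R p ^ 3 + Sf R p / R] := by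
  have hu' : (fun q => (u q : ℂ)) = Uf R := funext hu
  have hc : ContinuousAt (Sf R) p := by
    have := hS R p
    unfold HW at this
    exact this.continuousAt
  have hev : ∀ᶠ q in nhds p, Sf R q ≠ 0 := hc.eventually_ne h0
  have e1 : pzBarDeriv (Uf R) =ᶠ[nhds p] fun q => Qf R q * (Sf R q)⁻¹ := by
    filter_upwards [hev] with q hq
    obtain ⟨a, c, h⟩ := hU1 R hR q hq
    exact h.pzb
  have e2 : pwBarDeriv (Uf R) =ᶠ[nhds p] Wf R := by
    filter_upwards [hev] with q hq
    obtain ⟨a, c, h⟩ := hU1 R hR q hq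
    exact h.pwb
  obtain ⟨b, d, h1⟩ := hZb R p h0
  obtain ⟨b', d', h2⟩ := hWb R hR p h0
  have h1' : HW (pzBarDeriv (Uf R)) p _ _ _ _ := HasFDerivAt.congr_of_eventuallyEq h1 e1
  have h2' : HW (pwBarDeriv (Uf R)) p _ _ _ _ := HasFDerivAt.congr_of_eventuallyEq h2 e2
  rw [complexHessian, hu', h1'.pz, h1'.pw, h2'.pz, h2'.pw]

theorem posdef_aux (R s : ℝ) (hR : 0 < R) (hs : 0 < s) (Q : ℂ) :
    (!![(R : ℂ) / s, R * Q / s ^ 2; R * (starRingEnd ℂ) Q / s ^ 2,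
      R * (Q * (starRingEnd ℂ) Q) / s ^ 3 + s / R] : Matrix (Fin 2) (Fin 2) ℂ).PosDef := by
  have hRc : (R : ℂ) ≠ 0 := by exact_mod_cast hR.ne'
  have hsc : (s : ℂ) ≠ 0 := by exact_mod_cast hs.ne'
  refine Matrix.PosDef.of_dotProduct_mulVec_pos ?_ ?_
  · ext i j
    fin_cases i <;> fin_cases j <;> simp [Matrix.conjTranspose, mul_comm]
  · intro x hx
    have key : dotProduct (star x) (Matrix.mulVec (!![(R : ℂ) / s, R * Q / s ^ 2;
        R * (starRingEnd ℂ) Q / s ^ 2,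
        R * (Q * (starRingEnd ℂ) Q) / s ^ 3 + s / R] : Matrix (Fin 2) (Fin 2) ℂ) x)
        = ((R / s * normSq (x 0 + Q / s * x 1) + s / R * normSq (x 1) : ℝ) : ℂ) := by
      push_cast
      rw [← mul_conj, ← mul_conj]
      simp [dotProduct, Matrix.mulVec, Fin.sum_univ_two]
      field_simp
      ring
    rw [key]
    have : 0 < R / s * normSq (x 0 + Q / s * x 1) + s / R * normSq (x 1) := by
      have n1 := normSq_nonneg (x 0 + Q / s * x 1)
      by_cases h1 : x 1 = 0
      · have h2 : x 0 ≠ 0 := by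
          intro h2; apply hx; ext i; fin_cases i <;> simp [h1, h2]
        have := normSq_pos.2 h2
        simp only [h1, mul_zero, add_zero, map_zero]
        positivity
      · have := normSq_pos.2 h1
        positivity
    exact_mod_cast this

/-- the explicit function
`u(z,w) = R|z|²/(R²−|w|²) + w̄z²/(2(R²−|w|²)) + wz̄²/(2(R²−|w|²)) + R|w|² − |w|⁴/(4R)`
is smooth, strictly plurisubharmonic and solves `det(∂∂̄u) = 1` on `ℂ × D_R`. -/
theorem stmt4 (R : ℝ) (hR : 0 < R)
    (u : ℂ × ℂ → ℝ)
    (hu : u = fun p =>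
      R * Complex.normSq p.1 / (R ^ 2 - Complex.normSq p.2)
        + (((starRingEnd ℂ) p.2 * p.1 ^ 2) / (2 * ((R ^ 2 - Complex.normSq p.2 : ℝ) : ℂ))
            + (p.2 * ((starRingEnd ℂ) p.1) ^ 2)
              / (2 * ((R ^ 2 - Complex.normSq p.2 : ℝ) : ℂ))).re
        + R * Complex.normSq p.2 - Complex.normSq p.2 ^ 2 / (4 * R)) :
    ContDiffOn ℝ (⊤ : ℕ∞) u (Set.univ ×ˢ Metric.ball (0 : ℂ) R) ∧
    ∀ p ∈ (Set.univ ×ˢ Metric.ball (0 : ℂ) R : Set (ℂ × ℂ)),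
      StrictPSHAt u p ∧ MAdet u p = 1 := by
  have hu' : ∀ q, (u q : ℂ) = Uf R q := by
    intro q; rw [hu]; exact u_eq R q
  have hpos : ∀ p ∈ (Set.univ ×ˢ Metric.ball (0 : ℂ) R : Set (ℂ × ℂ)),
      0 < R ^ 2 - normSq p.2 := by
    rintro p ⟨-, hp⟩
    have hp' : ‖p.2‖ < R := by simpa using hp
    rw [normSq_eq_norm_sq]
    nlinarith [norm_nonneg p.2]
  have hne : ∀ p ∈ (Set.univ ×ˢ Metric.ball (0 : ℂ) R : Set (ℂ × ℂ)), Sf R p ≠ 0 := by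
    intro p hp
    rw [hSR]
    exact_mod_cast (hpos p hp).ne'
  refine ⟨?_, ?_⟩
  · have e : u = fun q => Complex.reCLM (Uf R q) := by
      funext q; rw [← hu' q]; simp
    rw [e]
    have hc1 : ContDiff ℝ (⊤ : ℕ∞) (fun q : ℂ × ℂ => (starRingEnd ℂ) q.1) :=
      (Complex.conjCLE : ℂ →L[ℝ] ℂ).contDiff.comp contDiff_fst
    have hc2 : ContDiff ℝ (⊤ : ℕ∞) (fun q : ℂ × ℂ => (starRingEnd ℂ) q.2) :=
      (Complex.conjCLE : ℂ →L[ℝ] ℂ).contDiff.comp contDiff_snd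
    have hSc : ContDiff ℝ (⊤ : ℕ∞) (Sf R) := by
      unfold Sf; fun_prop
    have hi : ContDiffOn ℝ (⊤ : ℕ∞) (fun q => (Sf R q)⁻¹) (Set.univ ×ˢ Metric.ball (0 : ℂ) R) :=
      hSc.contDiffOn.inv hne
    refine Complex.reCLM.contDiff.comp_contDiffOn ?_
    unfold Uf
    refine ContDiffOn.add (ContDiffOn.mul (ContDiff.contDiffOn ?_) hi) (ContDiff.contDiffOn ?_)
    · fun_prop
    · fun_prop
  · intro p hp
    have hh := hess R hR u hu' p (hne p hp)
    have hRc : (R : ℂ) ≠ 0 := by exact_mod_cast hR.ne'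
    have h0 := hne p hp
    refine ⟨?_, ?_⟩
    · rw [StrictPSHAt, hh, hSR]
      exact posdef_aux R _ hR (hpos p hp) _
    · rw [MAdet, hh, Matrix.det_fin_two_of]
      field_simp
      ring
end
end

section
/- Let a, d : ℂ → ℝ and b, c : ℂ → ℂ be C² functions with a > 0, and suppose that u(z,w) = a(w)|z|² + b(w)z² + conj(b(w)z²) + c(w)z + conj(c(w)z) + d(w) satisfies det(∂∂̄u) = 1 at every point of ℂ². Then there exists w₀ ∈ ℂ such that b_w̄(w₀) = 0; that is, the zero set of b_w̄ is nonempty. -/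
open Complex
open scoped ComplexOrder

noncomputable section

open Topology Filter in
lemma aux_second_le {G : ℂ → ℝ} {x : ℂ} (hG : ContDiffAt ℝ 2 G x) (hm : IsLocalMax G x) (v : ℂ) :
    fderiv ℝ (fderiv ℝ G) x v v ≤ 0 := by
  have hev : ∀ᶠ y in 𝓝 x, DifferentiableAt ℝ G y := by
    have := hG.eventually (by simp)
    filter_upwards [this] with y hy
    exact hy.differentiableAt (by simp)
  have hl : ∀ t : ℝ, HasDerivAt (fun t : ℝ => x + t * v) v t := by
    intro t
    have := (((hasDerivAt_id t).ofReal_comp).mul_const v).const_add x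
    simpa using this
  have hl0 : Tendsto (fun t : ℝ => x + t * v) (𝓝 0) (𝓝 x) := by
    have := (hl 0).continuousAt.tendsto
    simpa using this
  have hd1 : ∀ᶠ t in 𝓝 (0:ℝ), deriv (fun t : ℝ => G (x + t * v)) t = fderiv ℝ G (x + t * v) v := by
    filter_upwards [hl0.eventually hev] with t ht
    exact (ht.hasFDerivAt.comp_hasDerivAt t (hl t)).deriv
  have hd2 : deriv (deriv (fun t : ℝ => G (x + t * v))) 0 = fderiv ℝ (fderiv ℝ G) x v v := by
    rw [EventuallyEq.deriv_eq (f := fun t : ℝ => fderiv ℝ G (x + t * v) v) hd1]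
    have h1 : DifferentiableAt ℝ (fderiv ℝ G) x := by
      have : ContDiffAt ℝ 1 (fderiv ℝ G) x := hG.fderiv_right (by norm_num)
      exact this.differentiableAt (by simp)
    have hF : HasFDerivAt (fun y => fderiv ℝ G y v)
        ((ContinuousLinearMap.apply ℝ ℝ v).comp (fderiv ℝ (fderiv ℝ G) x)) x :=
      (ContinuousLinearMap.apply ℝ ℝ v).hasFDerivAt.comp x h1.hasFDerivAt
    have h2 := hF.comp_hasDerivAt_of_eq (0:ℝ) (hl 0) (by simp)
    exact h2.deriv
  by_contra! hpos
  rw [← hd2] at hpos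
  set g : ℝ → ℝ := fun t : ℝ => G (x + t * v) with hg
  have hgm : IsLocalMax g 0 := by
    have := hl0.eventually hm
    filter_upwards [this] with t ht
    simpa [hg] using ht
  have hgc : ContinuousAt g 0 := by
    have hx : ContinuousAt G (x + ((0:ℝ):ℂ) * v) := by simpa using hG.continuousAt
    exact ContinuousAt.comp (f := fun t : ℝ => x + t * v) (x := (0:ℝ)) hx (hl 0).continuousAt
  have hmin := isLocalMin_of_deriv_deriv_pos hpos hgm.deriv_eq_zero hgc
  have hconst : g =ᶠ[𝓝 0] fun _ => g 0 := by
    filter_upwards [hmin, hgm] with t h1 h2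
    exact le_antisymm h2 h1
  have h0 : deriv (deriv g) 0 = 0 := by
    have := hconst.deriv.deriv_eq
    simpa using this
  linarith

open Topology Filter in
lemma aux_log {f : ℂ → ℝ} {x : ℂ} (hf : ContDiffAt ℝ 2 f x) (h0 : 0 < f x) (v : ℂ) :
    fderiv ℝ (fderiv ℝ (fun y => Real.log (f y))) x v v =
      fderiv ℝ (fderiv ℝ f) x v v / f x - (fderiv ℝ f x v)^2 / (f x)^2 := by
  have hev : ∀ᶠ y in 𝓝 x, fderiv ℝ (fun y => Real.log (f y)) y = (f y)⁻¹ • fderiv ℝ f y := by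
    have h1 := hf.eventually (by simp)
    have h2 := hf.continuousAt.eventually (lt_mem_nhds h0)
    filter_upwards [h1, h2] with y hy hy2
    exact ((hy.differentiableAt (by simp)).hasFDerivAt.log hy2.ne').fderiv
  rw [EventuallyEq.fderiv_eq hev]
  have h1 : DifferentiableAt ℝ (fderiv ℝ f) x := by
    have : ContDiffAt ℝ 1 (fderiv ℝ f) x := hf.fderiv_right (by norm_num)
    exact this.differentiableAt (by simp)
  have h2 : HasFDerivAt f (fderiv ℝ f x) x := (hf.differentiableAt (by simp)).hasFDerivAt
  have h3 := ((hasDerivAt_inv h0.ne').comp_hasFDerivAt x h2).smul h1.hasFDerivAt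
  have h4 := h3.fderiv
  simp only [Function.comp_def] at h4
  change fderiv ℝ (fun y => (f y)⁻¹ • fderiv ℝ f y) x = _ at h4
  rw [h4]
  simp
  field_simp
  ring

open Laplacian InnerProductSpace in
lemma aux_lap (f : ℂ → ℝ) (x : ℂ) : Δ f x = fderiv ℝ (fderiv ℝ f) x 1 1 +
    fderiv ℝ (fderiv ℝ f) x I I := by
  rw [laplacian_eq_iteratedFDeriv_complexPlane]
  simp [iteratedFDeriv_two_apply]

lemma aux_hs (R : ℝ) (x : ℂ) : HasFDerivAt (fun y : ℂ => R^2 - normSq y)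
    (-(2 * x.re) • reCLM - (2 * x.im) • imCLM) x := by
  have h1 := reCLM.hasFDerivAt (x := x)
  have h2 := imCLM.hasFDerivAt (x := x)
  have := ((h1.mul h1).add (h2.mul h2)).const_sub (R^2)
  refine this.congr_fderiv ?_
  ext <;> simp <;> ring

lemma aux_hs2 (R : ℝ) (x v : ℂ) : fderiv ℝ (fderiv ℝ (fun y : ℂ => R^2 - normSq y)) x v v
    = - 2 * normSq v := by
  have : fderiv ℝ (fun y : ℂ => R^2 - normSq y) = fun x =>
    (-(2 * x.re) • reCLM - (2 * x.im) • imCLM) := by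
    funext x; exact (aux_hs R x).fderiv
  rw [this]
  have h1 := reCLM.hasFDerivAt (x := x)
  have h2 := imCLM.hasFDerivAt (x := x)
  have := (((h1.const_mul 2).neg.smul_const reCLM).sub ((h2.const_mul 2).smul_const imCLM)).fderiv
  simp only [reCLM_apply, imCLM_apply] at this
  erw [this]
  simp [normSq_apply]; ring

lemma aux_hsC (R : ℝ) : ContDiff ℝ 2 (fun y : ℂ => R^2 - normSq y) := by
  have : (fun y : ℂ => R^2 - normSq y) = fun y => R^2 - (reCLM y * reCLM y + imCLM y * imCLM y) := by
    funext y; simp [normSq_apply]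
  rw [this]
  fun_prop

open Laplacian InnerProductSpace Topology Filter in
/-- Ahlfors-type estimate. -/
lemma aux_main (a : ℂ → ℝ) (h : ℂ → ℂ) (ha : ContDiff ℝ 2 a) (hh : Differentiable ℂ h)
    (hapos : ∀ w, 0 < a w) (hne : ∀ w, h w ≠ 0)
    (hE : ∀ w, a w * (fderiv ℝ (fderiv ℝ a) w 1 1 + fderiv ℝ (fderiv ℝ a) w I I)
      - ((fderiv ℝ a w 1)^2 + (fderiv ℝ a w I)^2) = 16 * (a w)^4 * ‖h w‖^2) : False := by
  have key : ∀ R : ℝ, 0 < R → a 0 * ‖h 0‖ * R ≤ 1/2 := by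
    intro R hR
    have hcont : Continuous (fun w : ℂ => a w * ‖h w‖ * (R^2 - normSq w)) :=
      (ha.continuous.mul hh.continuous.norm).mul (aux_hsC R).continuous
    obtain ⟨x, hx, hmax⟩ := (isCompact_closedBall (0:ℂ) R).exists_isMaxOn
      ⟨0, by simp [hR.le]⟩ hcont.continuousOn
    have h0 : a 0 * ‖h 0‖ * R^2 ≤ a x * ‖h x‖ * (R^2 - normSq x) := by
      have := hmax (show (0:ℂ) ∈ Metric.closedBall 0 R by simp [hR.le])
      simpa using this
    have hp : ∀ w, 0 < a w * ‖h w‖ := fun w => mul_pos (hapos w) (norm_pos_iff.2 (hne w))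
    have hsx : 0 < R^2 - normSq x := by
      have : 0 < a x * ‖h x‖ * (R^2 - normSq x) := lt_of_lt_of_le (by have := hp 0; positivity) h0
      exact (mul_pos_iff_of_pos_left (hp x)).1 this
    have hxb : Metric.closedBall (0:ℂ) R ∈ 𝓝 x := by
      apply Metric.closedBall_mem_nhds_of_mem
      rw [normSq_eq_norm_sq] at hsx
      simp only [Metric.mem_ball, dist_zero_right]
      exact lt_of_pow_lt_pow_left₀ 2 hR.le (by linarith)
    have hlm : IsLocalMax (fun w : ℂ => a w * ‖h w‖ * (R^2 - normSq w)) x := hmax.isLocalMax hxb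
    have hpos := (aux_hsC R).continuous.continuousAt.eventually (lt_mem_nhds hsx)
    have hGm : IsLocalMax ((fun w => Real.log (a w)) + (fun w => Real.log ‖h w‖) +
        (fun w => Real.log (R^2 - normSq w))) x := by
      filter_upwards [hlm, hpos] with w hw1 hw2
      simp only [Pi.add_apply]
      have e : ∀ w, 0 < R^2 - normSq w → Real.log (a w) + Real.log ‖h w‖ + Real.log (R^2 - normSq w)
          = Real.log (a w * ‖h w‖ * (R^2 - normSq w)) := by
        intro w hw
        rw [Real.log_mul (hp w).ne' hw.ne', Real.log_mul (hapos w).ne' (norm_ne_zero_iff.2 (hne w))]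
      rw [e w hw2, e x hsx]
      exact Real.log_le_log (mul_pos (hp w) hw2) hw1
    have c1 : ContDiffAt ℝ 2 (fun w => Real.log (a w)) x := ha.contDiffAt.log (hapos x).ne'
    have hharm : HarmonicAt (fun w => Real.log ‖h w‖) x :=
      (hh.analyticAt x).harmonicAt_log_norm (hne x)
    have c2 : ContDiffAt ℝ 2 (fun w => Real.log ‖h w‖) x := hharm.1
    have c3 : ContDiffAt ℝ 2 (fun w : ℂ => Real.log (R^2 - normSq w)) x :=
      (aux_hsC R).contDiffAt.log hsx.ne'
    have c12 : ContDiffAt ℝ 2 ((fun w => Real.log (a w)) + (fun w => Real.log ‖h w‖)) x := c1.add c2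
    have c123 : ContDiffAt ℝ 2 ((fun w => Real.log (a w)) + (fun w => Real.log ‖h w‖) +
        (fun w => Real.log (R^2 - normSq w))) x := c12.add c3
    have hL : Δ ((fun w => Real.log (a w)) + (fun w => Real.log ‖h w‖) +
        (fun w => Real.log (R^2 - normSq w))) x ≤ 0 := by
      rw [aux_lap]
      have := aux_second_le c123 hGm 1
      have := aux_second_le c123 hGm I
      linarith
    rw [c12.laplacian_add c3, c1.laplacian_add c2, hharm.2.self_of_nhds, aux_lap, aux_lap,
      aux_log ha.contDiffAt (hapos x), aux_log ha.contDiffAt (hapos x),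
      aux_log (aux_hsC R).contDiffAt hsx, aux_log (aux_hsC R).contDiffAt hsx,
      aux_hs2, aux_hs2, (aux_hs R x).fderiv] at hL
    have hEx := hE x
    have hax := hapos x
    simp at hL
    have hxx := normSq_apply x
    set s := R^2 - normSq x with hs
    have e1 : fderiv ℝ (fderiv ℝ a) x 1 1 / a x - (fderiv ℝ a x 1)^2 / (a x)^2 +
      (fderiv ℝ (fderiv ℝ a) x I I / a x - (fderiv ℝ a x I)^2 / (a x)^2) = 16 * (a x)^2 * ‖h x‖^2 := by
      field_simp
      linear_combination hEx
    have e2 : -2 / s - (2 * x.re)^2 / s^2 + (-2/s - (2*x.im)^2/s^2) = - 4 * R^2 / s^2 := by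
      have : R^2 = s + (x.re*x.re+x.im*x.im) := by rw [hs]; linarith
      rw [this]; field_simp; ring
    rw [e1, e2] at hL
    have e3 : 16 * (a x * ‖h x‖ * s)^2 ≤ 4 * R^2 := by
      have : 16 * (a x)^2 * ‖h x‖^2 ≤ 4 * R^2 / s^2 := by
        have : -4 * R^2 / s^2 = - (4 * R^2 / s^2) := by ring
        linarith
      rw [le_div_iff₀ (by positivity)] at this
      linarith
    have e4 : a x * ‖h x‖ * s ≤ R / 2 := by
      apply le_of_sq_le_sq _ (by positivity)
      nlinarith
    have : (a 0 * ‖h 0‖ * R) * R ≤ (1/2) * R := by nlinarith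
    exact le_of_mul_le_mul_right this hR
  have hp : 0 < a 0 * ‖h 0‖ := mul_pos (hapos 0) (norm_pos_iff.2 (hne 0))
  have := key (1 / (a 0 * ‖h 0‖)) (by positivity)
  rw [mul_one_div_cancel hp.ne'] at this
  norm_num at this

lemma aux_snd {f m : ℂ → ℂ} {p : ℂ × ℂ} (hf : DifferentiableAt ℝ f p.2) (hm : DifferentiableAt ℝ m p.1) :
    HasFDerivAt (fun q : ℂ × ℂ => f q.2 * m q.1)
      (f p.2 • (fderiv ℝ m p.1).comp (ContinuousLinearMap.fst ℝ ℂ ℂ) +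
        m p.1 • (fderiv ℝ f p.2).comp (ContinuousLinearMap.snd ℝ ℂ ℂ)) p :=
  (hf.hasFDerivAt.comp p hasFDerivAt_snd).mul (hm.hasFDerivAt.comp p hasFDerivAt_fst)

lemma aux_sum {n : ℕ} {f m : Fin n → ℂ → ℂ} {p : ℂ × ℂ} (hf : ∀ i, DifferentiableAt ℝ (f i) p.2)
    (hm : ∀ i, DifferentiableAt ℝ (m i) p.1) (v : ℂ × ℂ) :
    fderiv ℝ (fun q : ℂ × ℂ => ∑ i, f i q.2 * m i q.1) p v =
      ∑ i, (f i p.2 * fderiv ℝ (m i) p.1 v.1 + m i p.1 * fderiv ℝ (f i) p.2 v.2) := by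
  rw [(HasFDerivAt.fun_sum fun i _ => aux_snd (hf i) (hm i)).fderiv]
  simp


lemma aux_pz {n : ℕ} {f m : Fin n → ℂ → ℂ} (hf : ∀ i, Differentiable ℝ (f i))
    (hm : ∀ i, Differentiable ℝ (m i)) : pzDeriv (fun q : ℂ × ℂ => ∑ i, f i q.2 * m i q.1) =
    fun p => ∑ i, f i p.2 * wDeriv (m i) p.1 := by
  funext p
  simp only [pzDeriv, wDeriv, aux_sum (fun i => hf i _) (fun i => hm i _)]
  rw [Finset.mul_sum, ← Finset.sum_sub_distrib, Finset.sum_div]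
  refine Finset.sum_congr rfl fun i _ => ?_
  simp; ring

lemma aux_pzb {n : ℕ} {f m : Fin n → ℂ → ℂ} (hf : ∀ i, Differentiable ℝ (f i))
    (hm : ∀ i, Differentiable ℝ (m i)) : pzBarDeriv (fun q : ℂ × ℂ => ∑ i, f i q.2 * m i q.1) =
    fun p => ∑ i, f i p.2 * wBarDeriv (m i) p.1 := by
  funext p
  simp only [pzBarDeriv, wBarDeriv, aux_sum (fun i => hf i _) (fun i => hm i _)]
  rw [Finset.mul_sum, ← Finset.sum_add_distrib, Finset.sum_div]
  refine Finset.sum_congr rfl fun i _ => ?_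
  simp; ring

lemma aux_pw {n : ℕ} {f m : Fin n → ℂ → ℂ} (hf : ∀ i, Differentiable ℝ (f i))
    (hm : ∀ i, Differentiable ℝ (m i)) : pwDeriv (fun q : ℂ × ℂ => ∑ i, f i q.2 * m i q.1) =
    fun p => ∑ i, wDeriv (f i) p.2 * m i p.1 := by
  funext p
  simp only [pwDeriv, wDeriv, aux_sum (fun i => hf i _) (fun i => hm i _)]
  rw [Finset.mul_sum, ← Finset.sum_sub_distrib, Finset.sum_div]
  refine Finset.sum_congr rfl fun i _ => ?_
  simp; ring

lemma aux_pwb {n : ℕ} {f m : Fin n → ℂ → ℂ} (hf : ∀ i, Differentiable ℝ (f i))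
    (hm : ∀ i, Differentiable ℝ (m i)) : pwBarDeriv (fun q : ℂ × ℂ => ∑ i, f i q.2 * m i q.1) =
    fun p => ∑ i, wBarDeriv (f i) p.2 * m i p.1 := by
  funext p
  simp only [pwBarDeriv, wBarDeriv, aux_sum (fun i => hf i _) (fun i => hm i _)]
  rw [Finset.mul_sum, ← Finset.sum_add_distrib, Finset.sum_div]
  refine Finset.sum_congr rfl fun i _ => ?_
  simp; ring

lemma aux_wbd {F : ℂ → ℂ} (hF : ContDiff ℝ 2 F) : Differentiable ℝ (wBarDeriv F) := by
  have h1 : Differentiable ℝ (fderiv ℝ F) :=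
    (hF.fderiv_right (m := 1) (by norm_num)).differentiable (by simp)
  unfold wBarDeriv
  fun_prop

def mm : Fin 6 → ℂ → ℂ := ![fun z => z * conjCLE z, fun z => z^2, fun z => (conjCLE z)^2,
  fun z => z, fun z => conjCLE z, fun _ => 1]
def mmb : Fin 6 → ℂ → ℂ := ![fun z => z, fun _ => 0, fun z => 2 * conjCLE z,
  fun _ => 0, fun _ => 1, fun _ => 0]
def mmw : Fin 6 → ℂ → ℂ := ![fun z => conjCLE z, fun z => 2 * z, fun _ => 0,
  fun _ => 1, fun _ => 0, fun _ => 0]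
def mmbw : Fin 6 → ℂ → ℂ := ![fun _ => 1, fun _ => 0, fun _ => 0,
  fun _ => 0, fun _ => 0, fun _ => 0]

lemma fd_id (z : ℂ) : HasFDerivAt (fun z : ℂ => z) (ContinuousLinearMap.id ℝ ℂ) z := hasFDerivAt_id z
lemma fd_conj (z : ℂ) : HasFDerivAt (fun z : ℂ => conjCLE z) (conjCLE : ℂ →L[ℝ] ℂ) z :=
  conjCLE.hasFDerivAt

lemma mm_diff (i : Fin 6) : Differentiable ℝ (mm i) := by
  fin_cases i <;> simp [mm] <;> fun_prop
lemma mmb_diff (i : Fin 6) : Differentiable ℝ (mmb i) := by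
  fin_cases i <;> simp [mmb] <;> fun_prop

lemma mm_b (i : Fin 6) : wBarDeriv (mm i) = mmb i := by
  funext z
  have h0 := fd_id z
  have h1 := fd_conj z
  fin_cases i <;> simp [mm, mmb, wBarDeriv]
  · have := (h0.mul h1).fderiv
    simp at this; erw [this]; simp; linear_combination ((starRingEnd ℂ z - z)/2) * I_sq
  · have := (h0.pow 2).fderiv
    simp at this
    erw [this]; simp; linear_combination 2 * z * I_sq
  · have := (h1.pow 2).fderiv
    simp at this
    erw [this]; simp; linear_combination (-starRingEnd ℂ z) * I_sq
  · erw [h1.fderiv]; simp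

lemma mm_w (i : Fin 6) : wDeriv (mm i) = mmw i := by
  funext z
  have h0 := fd_id z
  have h1 := fd_conj z
  fin_cases i <;> simp [mm, mmw, wDeriv]
  · have := (h0.mul h1).fderiv
    simp at this; erw [this]; simp; linear_combination ((z-starRingEnd ℂ z)/2) * I_sq
  · have := (h0.pow 2).fderiv
    simp at this
    erw [this]; simp; linear_combination (-z) * I_sq
  · have := (h1.pow 2).fderiv
    simp at this
    erw [this]; simp; linear_combination 2 * (starRingEnd ℂ z) * I_sq
  · erw [h1.fderiv]; simp

lemma mmb_w (i : Fin 6) : wDeriv (mmb i) = mmbw i := by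
  funext z
  have h1 := fd_conj z
  fin_cases i <;> simp [mmb, mmbw, wDeriv]
  have := (h1.const_mul 2).fderiv
  simp at this
  erw [this]; simp; linear_combination 2 * I_sq

lemma aux_poly {α β γ δ ε ζ : ℂ} (h : ∀ z : ℂ, α * (z * starRingEnd ℂ z) + β * z^2 +
    γ * (starRingEnd ℂ z)^2 + δ * z + ε * starRingEnd ℂ z + ζ = 0) : α = 0 ∧ β = 0 := by
  have z0 := h 0
  have z1 := h 1
  have z2 := h (-1)
  have z3 := h I
  have z4 := h (-I)
  have z5 := h (1+I)
  have z6 := h (-(1+I))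
  simp only [map_zero, map_one, map_neg, map_add, conj_I] at z0 z1 z2 z3 z4 z5 z6
  have e1 : α + β + γ + ζ = 0 := by linear_combination (z1 + z2)/2
  have e0 : ζ = 0 := by linear_combination z0
  have e3 : α - β - γ + ζ = 0 := by
    linear_combination (z3 + z4)/2 + (α - β - γ) * I_sq
  have e5 : 2 * α + 2 * I * β - 2 * I * γ + ζ = 0 := by
    linear_combination (z5 + z6)/2 + (α - β - γ) * I_sq
  have ha : α = 0 := by linear_combination (e1 + e3)/2 - e0
  refine ⟨ha, ?_⟩
  linear_combination (e1 - e3)/4 - I/4 * (e5 - 2 * ha - e0) + (β-γ)/2 * I_sq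

lemma aux_sys (a d : ℂ → ℝ) (b c : ℂ → ℂ)
    (ha : ContDiff ℝ 2 a) (hd : ContDiff ℝ 2 d)
    (hb : ContDiff ℝ 2 b) (hc : ContDiff ℝ 2 c)
    (heq : ∀ p : ℂ × ℂ, MAdet (smae a d b c) p = 1) (w : ℂ) :
    (a w : ℂ) * wBarWDeriv (fun v => (a v : ℂ)) w
        = wBarDeriv (fun v => (a v : ℂ)) w * wDeriv (fun v => (a v : ℂ)) w
          + 4 * (wBarDeriv b w * wDeriv (fun v => conjCLE (b v)) w) ∧
    (a w : ℂ) * wBarWDeriv b w = 2 * wDeriv (fun v => (a v : ℂ)) w * wBarDeriv b w := by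
  set f : Fin 6 → ℂ → ℂ := ![fun v => (a v : ℂ), b, fun v => conjCLE (b v), c, fun v => conjCLE (c v),
    fun v => (d v : ℂ)] with hf
  have hu : (fun q => ((smae a d b c q : ℝ) : ℂ)) = fun q => ∑ i, f i q.2 * mm i q.1 := by
    funext q
    simp only [Fin.sum_univ_six, hf, mm, smae]
    simp
    rw [normSq_eq_conj_mul_self]
    apply Complex.ext <;> simp [pow_two] <;> ring
  have hfC : ∀ i, ContDiff ℝ 2 (f i) := by
    have ha' : ContDiff ℝ 2 (fun v => (a v : ℂ)) := ofRealCLM.contDiff.comp ha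
    have hd' : ContDiff ℝ 2 (fun v => (d v : ℂ)) := ofRealCLM.contDiff.comp hd
    have hb' : ContDiff ℝ 2 (fun v => conjCLE (b v)) := conjCLE.contDiff.comp hb
    have hc' : ContDiff ℝ 2 (fun v => conjCLE (c v)) := conjCLE.contDiff.comp hc
    intro i
    fin_cases i
    exacts [ha', hb, hb', hc, hc', hd']
  have hfd : ∀ i, Differentiable ℝ (f i) := fun i => (hfC i).differentiable (by simp)
  have hfb : ∀ i, Differentiable ℝ (wBarDeriv (f i)) := fun i => aux_wbd (hfC i)
  have hdet : ∀ z : ℂ, _ := fun z => heq (z, w)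
  simp only [MAdet, complexHessian, Matrix.det_fin_two_of, hu, aux_pzb hfd mm_diff,
    aux_pwb hfd mm_diff, mm_b, aux_pz hfd mmb_diff, aux_pw hfd mmb_diff, aux_pz hfb mm_diff,
    aux_pw hfb mm_diff, mm_w, mmb_w] at hdet
  simp [Fin.sum_univ_six, hf, mm, mmb, mmw, mmbw] at hdet
  simp only [wBarWDeriv]
  set A := wDeriv (wBarDeriv fun v => (a v : ℂ)) w
  set A1 := wBarDeriv (fun v => (a v : ℂ)) w
  set A2 := wDeriv (fun v => (a v : ℂ)) w
  set B := wDeriv (wBarDeriv b) w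
  set B1 := wBarDeriv b w
  set B2 := wDeriv (wBarDeriv fun v => starRingEnd ℂ (b v)) w
  set B3 := wDeriv (fun v => starRingEnd ℂ (b v)) w with hB3
  set C := wDeriv (wBarDeriv c) w
  set C1 := wBarDeriv c w
  set C2 := wDeriv (wBarDeriv fun v => starRingEnd ℂ (c v)) w
  set C3 := wDeriv (fun v => starRingEnd ℂ (c v)) w
  set D := wDeriv (wBarDeriv fun v => (d v : ℂ)) w
  have := aux_poly (α := a w * A - A1 * A2 - 4 * B1 * B3) (β := a w * B - 2 * B1 * A2)
    (γ := a w * B2 - 2 * A1 * B3) (δ := a w * C - 2 * B1 * C3 - C1 * A2)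
    (ε := a w * C2 - A1 * C3 - 2 * C1 * B3) (ζ := a w * D - C1 * C3 - 1)
    (fun z => by linear_combination hdet z)
  simp only [conjCLE_apply, ← hB3]
  exact ⟨by linear_combination this.1, by linear_combination this.2⟩

/-- for every entire `C²` solution of `det(∂∂̄u) = 1` on `ℂ²` of the
form (smae), the zero set of `b_w̄` is nonempty. -/
theorem stmt6 (a d : ℂ → ℝ) (b c : ℂ → ℂ)
    (ha : ContDiff ℝ 2 a) (hd : ContDiff ℝ 2 d)
    (hb : ContDiff ℝ 2 b) (hc : ContDiff ℝ 2 c)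
    (hapos : ∀ w : ℂ, 0 < a w)
    (heq : ∀ p : ℂ × ℂ, MAdet (smae a d b c) p = 1) :
    ∃ w₀ : ℂ, wBarDeriv b w₀ = 0 := by
  by_contra! hne
  have hc2 : starRingEnd ℂ 2 = 2 := map_ofNat _ 2
  have had : Differentiable ℝ a := ha.differentiable (by simp)
  have had2 : Differentiable ℝ (fderiv ℝ a) :=
    (ha.fderiv_right (m := 1) (by norm_num)).differentiable (by simp)
  have hbd : Differentiable ℝ b := hb.differentiable (by simp)
  have hkd : Differentiable ℝ (wBarDeriv b) := aux_wbd hb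
  have hA : ∀ w v, fderiv ℝ (fun v => (a v : ℂ)) w v = (fderiv ℝ a w v : ℂ) := by
    intro w v
    have := (ofRealCLM.hasFDerivAt.comp w (had w).hasFDerivAt).fderiv
    exact congrArg (fun L => L v) this
  have hB : ∀ w, wDeriv (fun v => conjCLE (b v)) w = starRingEnd ℂ (wBarDeriv b w) := by
    intro w
    have := (conjCLE.hasFDerivAt.comp w (hbd w).hasFDerivAt).fderiv
    have h2 : ∀ v, fderiv ℝ (fun v => conjCLE (b v)) w v = starRingEnd ℂ (fderiv ℝ b w v) := by
      intro v
      exact congrArg (fun L => L v) this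
    simp only [wDeriv, wBarDeriv, h2]
    simp [hc2]
    ring
  have hAA : ∀ w, (wBarWDeriv (fun v => (a v : ℂ)) w).re =
      (fderiv ℝ (fderiv ℝ a) w 1 1 + fderiv ℝ (fderiv ℝ a) w I I) / 4 := by
    intro w
    have e : wBarDeriv (fun v => (a v : ℂ)) =
        fun w => ((fderiv ℝ a w 1 : ℂ) + I * (fderiv ℝ a w I : ℂ)) / 2 := by
      funext w
      simp only [wBarDeriv, hA]
    have hv : ∀ u, HasFDerivAt (fun w => (fderiv ℝ a w u : ℂ))
        ((ofRealCLM.comp (ContinuousLinearMap.apply ℝ ℝ u)).comp (fderiv ℝ (fderiv ℝ a) w)) w := by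
      intro u
      exact (ofRealCLM.comp (ContinuousLinearMap.apply ℝ ℝ u)).hasFDerivAt.comp w (had2 w).hasFDerivAt
    have e2 : ∀ v, fderiv ℝ (wBarDeriv (fun v => (a v : ℂ))) w v =
        ((fderiv ℝ (fderiv ℝ a) w v 1 : ℂ) + I * (fderiv ℝ (fderiv ℝ a) w v I : ℂ)) * 2⁻¹ := by
      intro v
      rw [e]
      have := (((hv 1).add ((hv I).const_mul I)).mul_const (2⁻¹ : ℂ)).fderiv
      simp only [div_eq_mul_inv]
      erw [this]
      simp
      ring
    have h2 : (2⁻¹ : ℂ) = ((2⁻¹ : ℝ) : ℂ) := by simp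
    rw [wBarWDeriv, wDeriv, div_eq_mul_inv, e2, e2, h2]
    simp
    ring
  have hsys := aux_sys a d b c ha hd hb hc heq
  have hane : ∀ w, a w ≠ 0 := fun w => (hapos w).ne'
  refine aux_main a (fun w => ((a w ^ 2)⁻¹ : ℝ) • conjCLE (wBarDeriv b w)) ha ?_ hapos ?_ ?_
  · intro w
    rw [differentiableAt_complex_iff_differentiableAt_real]
    have h1 := ((had w).hasFDerivAt.pow 2)
    have h2 := (hasDerivAt_inv (pow_ne_zero 2 (hane w))).comp_hasFDerivAt w h1
    have h3 := conjCLE.hasFDerivAt.comp w (hkd w).hasFDerivAt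
    have h4 : HasFDerivAt (fun w => ((a w ^ 2)⁻¹ : ℝ) • conjCLE (wBarDeriv b w)) _ w := h2.smul h3
    refine ⟨h4.differentiableAt, ?_⟩
    rw [h4.fderiv]
    have hs := congrArg (starRingEnd ℂ) (hsys w).2
    simp only [wBarWDeriv, wDeriv, hA] at hs
    simp [hc2] at hs
    have := hapos w
    have hc0 : (a w : ℂ) ≠ 0 := by exact_mod_cast hane w
    simp
    field_simp
    linear_combination (-2 * I) * hs + (a w * starRingEnd ℂ (fderiv ℝ (wBarDeriv b) w I) -
      2 * fderiv ℝ a w I * starRingEnd ℂ (wBarDeriv b w)) * I_sq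
  · intro w
    simp [hane w, hne w]
  · intro w
    have h1 := congrArg Complex.re (hsys w).1
    rw [hB, mul_conj, re_ofReal_mul, hAA] at h1
    have h3 : ‖((a w ^ 2)⁻¹ : ℝ) • conjCLE (wBarDeriv b w)‖^2 = normSq (wBarDeriv b w) / (a w)^4 := by
      rw [norm_smul, mul_pow, normSq_eq_norm_sq]
      simp
      field_simp
    simp only [h3]
    generalize wBarDeriv b w = k at h1
    simp only [wDeriv, wBarDeriv, hA] at h1
    simp at h1
    have := hane w
    field_simp
    linear_combination 4 * h1
end
end

section
/- Let a, b, c : ℝ^m → ℝ be smooth with a > 0, and suppose u(t,x) := a(x)t² + b(x)t + c(x) satisfies Donaldson's equation u_tt·Δu − |∇u_t|² = 1 at every point of ℝ × ℝ^m. Then a is a constant function, Δb = 0 on ℝ^m, and Δc = (|∇b|² + 1)/(2a) on ℝ^m. -/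
open scoped RealInnerProductSpace

noncomputable section

/-- The Laplacian of `f : ℝ^m → ℝ`, as the sum of second partial derivatives. -/
def lap {m : ℕ} (f : EuclideanSpace ℝ (Fin m) → ℝ) (x : EuclideanSpace ℝ (Fin m)) : ℝ :=
  ∑ i, fderiv ℝ (fderiv ℝ f) x (EuclideanSpace.single i 1) (EuclideanSpace.single i 1)

/-- Donaldson's operator `u_tt Δu − |∇u_t|²`, where the Laplacian and gradient are in
the space variable `x` only and subscripts `t` denote derivatives in `t`. -/
def donaldsonOp {m : ℕ} (u : ℝ × EuclideanSpace ℝ (Fin m) → ℝ)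
    (p : ℝ × EuclideanSpace ℝ (Fin m)) : ℝ :=
  fderiv ℝ (fun q => fderiv ℝ u q (1, 0)) p (1, 0) * lap (fun y => u (p.1, y)) p.2
    - ‖gradient (fun y => fderiv ℝ u (p.1, y) (1, 0)) p.2‖ ^ 2

open MeasureTheory Filter Topology

lemma hasDerivAt_posPart_pow (k : ℕ) (t : ℝ) :
    HasDerivAt (fun t : ℝ => (max t 0) ^ (k+2)) ((k+2) * (max t 0) ^ (k+1)) t := by
  rcases lt_trichotomy t 0 with h | h | h
  · have h1 : (fun t : ℝ => (max t 0) ^ (k+2)) =ᶠ[𝓝 t] fun _ => 0 := by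
      filter_upwards [Iio_mem_nhds h] with s hs
      rw [max_eq_right (le_of_lt hs)]; simp
    rw [max_eq_right h.le]
    simpa using (hasDerivAt_const t (0:ℝ)).congr_of_eventuallyEq h1
  · subst h
    have h1 : (fun t : ℝ => (max t 0) ^ (k+2)) =O[𝓝 0] fun t : ℝ => ‖t - 0‖ ^ (k+2) := by
      apply Asymptotics.IsBigO.of_bound 1
      refine Eventually.of_forall fun t => ?_
      simp only [sub_zero, norm_pow, norm_norm, one_mul]
      apply pow_le_pow_left₀ (norm_nonneg _)
      rw [Real.norm_eq_abs, Real.norm_eq_abs, abs_of_nonneg (le_max_right _ _)]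
      exact max_le (le_abs_self _) (abs_nonneg _)
    have h2 := (h1.hasFDerivAt (𝕜 := ℝ) (by omega)).hasDerivAt
    simpa using h2
  · have h1 : (fun t : ℝ => (max t 0) ^ (k+2)) =ᶠ[𝓝 t] fun t => t ^ (k+2) := by
      filter_upwards [Ioi_mem_nhds h] with s hs
      rw [max_eq_left (le_of_lt hs)]
    rw [max_eq_left h.le]
    simpa using (hasDerivAt_pow (k+2) t).congr_of_eventuallyEq h1

section
variable {m : ℕ}

local notation "𝔼" => EuclideanSpace ℝ (Fin m)

def Pb (k : ℕ) (y : EuclideanSpace ℝ (Fin m)) : ℝ := (max (1 - ‖y‖^2) 0) ^ k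

lemma Pb_cont (k : ℕ) : Continuous (Pb k : 𝔼 → ℝ) := by
  unfold Pb; fun_prop

lemma Pb_nonneg (k : ℕ) (y : 𝔼) : 0 ≤ Pb k y := pow_nonneg (le_max_right _ _) _

lemma Pb_zero (k : ℕ) (y : 𝔼) (hy : 1 ≤ ‖y‖) : Pb (k+1) y = 0 := by
  unfold Pb
  rw [max_eq_right (by nlinarith)]; simp

lemma Pb_supp (k : ℕ) : HasCompactSupport (Pb (k+1) : 𝔼 → ℝ) := by
  apply HasCompactSupport.intro (isCompact_closedBall (0:𝔼) 1)
  intro x hx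
  apply Pb_zero
  simp at hx
  exact hx.le

lemma Pb_hasFDerivAt (k : ℕ) (y : 𝔼) :
    HasFDerivAt (Pb (k+2) : 𝔼 → ℝ)
      ((-(2 * ((k:ℝ)+2) * Pb (k+1) y)) • innerSL ℝ y) y := by
  have h1 := (hasStrictFDerivAt_norm_sq y).hasFDerivAt.const_sub 1
  have h2 := (hasDerivAt_posPart_pow k (1 - ‖y‖^2)).comp_hasFDerivAt y h1
  refine HasFDerivAt.congr_fderiv (f := (Pb (k+2) : 𝔼 → ℝ)) h2 ?_
  ext z
  simp [Pb]
  ring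

lemma Pb_integrable {f : 𝔼 → ℝ} (hf : Continuous f) (k : ℕ) :
    Integrable (fun y => f y * Pb (k+1) y) :=
  (hf.mul (Pb_cont _)).integrable_of_hasCompactSupport ((Pb_supp k).mul_left)

lemma Pb_pos (k : ℕ) : 0 < ∫ y : 𝔼, Pb (k+1) y := by
  refine (Pb_cont (k+1)).integral_pos_of_hasCompactSupport_nonneg_nonzero (x := 0) (Pb_supp k)
    (Pb_nonneg _) ?_
  simp [Pb]

/-- integration by parts -/
lemma Pb_ibp {f : 𝔼 → ℝ} (hf : ContDiff ℝ 1 f) (k : ℕ) (e : 𝔼) :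
    ∫ y, f y * (2 * ((k:ℝ)+2) * Pb (k+1) y * inner ℝ y e) = ∫ y, fderiv ℝ f y e * Pb (k+2) y := by
  have hfd : ∀ y, fderiv ℝ (Pb (k+2) : 𝔼 → ℝ) y e = -(2 * ((k:ℝ)+2) * Pb (k+1) y * inner ℝ y e) := by
    intro y
    rw [(Pb_hasFDerivAt k y).fderiv]
    simp
  have hc : Continuous fun y => fderiv ℝ f y e := (hf.continuous_fderiv (by simp)).clm_apply continuous_const
  have := integral_mul_fderiv_eq_neg_fderiv_mul_of_integrable (μ := (volume : Measure 𝔼))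
    (f := f) (g := Pb (k+2)) (v := e) (Pb_integrable hc (k+1)) ?_
    (Pb_integrable hf.continuous (k+1))
    (fun x _ => (hf.differentiable (by simp)) x) (fun x _ => (Pb_hasFDerivAt k x).differentiableAt)
  · simp only [hfd, mul_neg, integral_neg, neg_inj] at this
    exact this
  · simp only [hfd]
    have h3 : Continuous fun y : 𝔼 => f y * -(2 * ((k:ℝ)+2) * inner ℝ y e) := by
      have := hf.continuous
      fun_prop
    refine (Pb_integrable h3 k).congr (Eventually.of_forall fun y => ?_)
    simp only
    ring

/-- differentiation under the integral -/
lemma Pb_deriv {v : 𝔼 → ℝ} (hv : ContDiff ℝ 1 v) (k : ℕ) (p q : 𝔼 → 𝔼)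
    (hp : Continuous p) (hq : Continuous q) (s₀ : ℝ) :
    HasDerivAt (fun s : ℝ => ∫ y, v (p y + s • q y) * Pb (k+1) y)
      (∫ y, fderiv ℝ v (p y + s₀ • q y) (q y) * Pb (k+1) y) s₀ := by
  have hvc := hv.continuous
  have hvd := hv.continuous_fderiv (by simp)
  have hK : IsCompact (Metric.closedBall s₀ 1 ×ˢ Metric.closedBall (0:𝔼) 1) :=
    (isCompact_closedBall _ _).prod (isCompact_closedBall _ _)
  obtain ⟨C, hC⟩ := hK.exists_bound_of_continuousOn
    (f := fun z : ℝ × 𝔼 => fderiv ℝ v (p z.2 + z.1 • q z.2) (q z.2))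
    (Continuous.continuousOn (by fun_prop))
  refine (hasDerivAt_integral_of_dominated_loc_of_deriv_le
    (F := fun s y => v (p y + s • q y) * Pb (k+1) y)
    (F' := fun s y => fderiv ℝ v (p y + s • q y) (q y) * Pb (k+1) y)
    (bound := fun y => C * Pb (k+1) y)
    (Metric.closedBall_mem_nhds s₀ one_pos) ?_ ?_ ?_ ?_ ?_ ?_).2
  · refine Eventually.of_forall fun s => ?_
    exact (Pb_integrable (by fun_prop) k).aestronglyMeasurable
  · exact (Pb_integrable (by fun_prop) k)
  · exact (Pb_integrable (by fun_prop) k).aestronglyMeasurable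
  · refine Eventually.of_forall fun y s hs => ?_
    rw [norm_mul, Real.norm_of_nonneg (Pb_nonneg _ _)]
    by_cases hy : 1 ≤ ‖y‖
    · simp [Pb_zero k y hy]
    · refine mul_le_mul_of_nonneg_right (hC (s, y) ⟨hs, ?_⟩) (Pb_nonneg _ _)
      simpa using (not_le.1 hy).le
  · exact Pb_integrable continuous_const k
  · refine Eventually.of_forall fun y s _ => ?_
    refine HasDerivAt.mul_const ?_ _
    have h1 : HasDerivAt (fun s : ℝ => p y + s • q y) (q y) s := by
      simpa using ((hasDerivAt_id s).smul_const (q y)).const_add (p y)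
    exact ((hv.differentiable (by simp) _).hasFDerivAt).comp_hasDerivAt s h1

lemma fderiv_affine {f : 𝔼 → ℝ} (hf : Differentiable ℝ f) (x : 𝔼) (s : ℝ) (y e : 𝔼) :
    fderiv ℝ (fun y => f (x + s • y)) y e = s * fderiv ℝ f (x + s • y) e := by
  have h1 : HasFDerivAt (fun y : 𝔼 => x + s • y) (s • ContinuousLinearMap.id ℝ 𝔼) y :=
    ((hasFDerivAt_id y).const_smul s).const_add x
  have h2 := (hf (x + s • y)).hasFDerivAt.comp y h1
  have h3 : fderiv ℝ (fun y => f (x + s • y)) y = _ := h2.fderiv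
  rw [h3]; simp

lemma mean_value {v : 𝔼 → ℝ} (hv : ContDiff ℝ 2 v) (hl : ∀ x, lap v x = 0) (k : ℕ) (x : 𝔼) (s : ℝ) :
    ∫ y, v (x + s • y) * Pb (k+1) y = v x * ∫ y : 𝔼, Pb (k+1) y := by
  have hv1 : ContDiff ℝ 1 v := hv.of_le (by norm_num)
  have hdv : ContDiff ℝ 1 (fderiv ℝ v) := hv.fderiv_right (by norm_num)
  have hd : ∀ s : ℝ, HasDerivAt (fun s : ℝ => ∫ y, v (x + s • y) * Pb (k+1) y) 0 s := by
    intro s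
    have h := Pb_deriv hv1 k (fun _ => x) (fun y => y) continuous_const continuous_id s
    convert h using 1
    symm
    have hDi : ∀ i : Fin m, ContDiff ℝ 1 (fun z => fderiv ℝ v z (EuclideanSpace.single i 1)) :=
      fun i => hdv.clm_apply contDiff_const
    have e1 : ∀ y : 𝔼, fderiv ℝ v (x + s • y) y * Pb (k+1) y =
        ∑ i, (2 * ((k:ℝ)+2))⁻¹ * (fderiv ℝ v (x + s • y) (EuclideanSpace.single i 1) *
          (2 * ((k:ℝ)+2) * Pb (k+1) y * inner ℝ y (EuclideanSpace.single i 1))) := by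
      intro y
      have : fderiv ℝ v (x + s • y) y = ∑ i, y i * fderiv ℝ v (x + s • y) (EuclideanSpace.single i 1) := by
        generalize fderiv ℝ v (x + s • y) = L
        conv_lhs => rw [← (EuclideanSpace.basisFun (Fin m) ℝ).sum_repr y]
        rw [map_sum]
        simp
      rw [this, Finset.sum_mul]
      refine Finset.sum_congr rfl fun i _ => ?_
      have : (k:ℝ) + 2 ≠ 0 := by positivity
      simp [EuclideanSpace.inner_single_right]
      field_simp
    have hcd : ∀ i : Fin m, ContDiff ℝ 1 (fun y => fderiv ℝ v (x + s • y) (EuclideanSpace.single i 1)) := by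
      intro i
      exact (hDi i).comp (f := fun y : 𝔼 => x + s • y) (by fun_prop)
    have hff : ∀ (i : Fin m) (z : 𝔼), fderiv ℝ (fun z => fderiv ℝ v z (EuclideanSpace.single i 1)) z (EuclideanSpace.single i 1)
        = fderiv ℝ (fderiv ℝ v) z (EuclideanSpace.single i 1) (EuclideanSpace.single i 1) := by
      intro i z
      have h1 := ((hdv.differentiable (by simp)) z).hasFDerivAt.clm_apply
        (hasFDerivAt_const (EuclideanSpace.single i (1:ℝ)) z)
      rw [h1.fderiv]; simp
    simp only [e1]
    rw [integral_finsetSum]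
    · simp only [integral_const_mul, Pb_ibp (hcd _),
        fderiv_affine ((hDi _).differentiable (by simp)), hff]
      rw [← Finset.mul_sum, ← integral_finsetSum]
      · simp only [← Finset.sum_mul, ← Finset.mul_sum]
        have : ∀ z, ∑ i, fderiv ℝ (fderiv ℝ v) z (EuclideanSpace.single i 1) (EuclideanSpace.single i 1) = 0 := hl
        simp [this]
      · intro i _
        have hc2 := hdv.continuous_fderiv (by simp)
        exact Pb_integrable (by fun_prop) (k+1)
    · intro i _
      have h3 : Continuous fun y : 𝔼 => (2 * ((k:ℝ)+2))⁻¹ * (fderiv ℝ v (x + s • y) (EuclideanSpace.single i 1) *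
          (2 * ((k:ℝ)+2) * inner ℝ y (EuclideanSpace.single i 1))) := by
        have := (hcd i).continuous
        fun_prop
      refine (Pb_integrable h3 k).congr (Eventually.of_forall fun y => ?_)
      simp only
      ring
  have hconst := is_const_of_deriv_eq_zero (fun s => (hd s).differentiableAt) (fun s => (hd s).deriv) s 0
  rw [hconst]
  simp [integral_const_mul]

lemma liouville_pos {v : 𝔼 → ℝ} (hv : ContDiff ℝ 2 v) (hl : ∀ x, lap v x = 0) (hp : ∀ x, 0 < v x)
    (x y : 𝔼) : v x = v y := by
  have hv1 : ContDiff ℝ 1 v := hv.of_le (by norm_num)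
  have hvc := hv1.continuous
  refine is_const_of_fderiv_eq_zero (𝕜 := ℝ) (hv1.differentiable (by simp)) (fun x => ?_) x y
  ext e
  simp only [_root_.zero_apply]
  set M₁ := ∫ y : 𝔼, Pb 1 y
  set M₂ := ∫ y : 𝔼, Pb 2 y
  have hM₂ : 0 < M₂ := Pb_pos 1
  have key : ∀ r : ℝ, 0 < r → r * |fderiv ℝ v x e * M₂| ≤ 4 * ‖e‖ * (v x * M₁) := by
    intro r hr
    have h1 := Pb_deriv hv1 1 (fun y => x + r • y) (fun _ => e) (by fun_prop) continuous_const 0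
    have h2 : (fun s : ℝ => ∫ y, v (x + r • y + s • e) * Pb (1+1) y) = fun s => v (x + s • e) * M₂ := by
      funext s
      rw [← mean_value hv hl 1 (x + s • e) r]
      congr 1; funext y; congr 2; abel
    rw [h2] at h1
    have h3 : HasDerivAt (fun s : ℝ => v (x + s • e) * M₂) (fderiv ℝ v x e * M₂) 0 := by
      have := ((hv1.differentiable (by simp) x).hasFDerivAt.hasLineDerivAt e)
      exact HasDerivAt.mul_const this _
    have h4 := h3.unique h1
    simp only [zero_smul, add_zero] at h4
    have hcd : ContDiff ℝ 1 (fun y => v (x + r • y)) := hv1.comp (f := fun y : 𝔼 => x + r • y) (by fun_prop)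
    have h5 := Pb_ibp hcd 0 e
    simp only [fderiv_affine (hv1.differentiable (by simp)), mul_assoc r, integral_const_mul] at h5
    have h6 : r * (fderiv ℝ v x e * M₂) = ∫ y, v (x + r • y) * (2 * (((0:ℕ):ℝ)+2) * Pb (0+1) y * inner ℝ y e) := by
      rw [h5, h4]
    have h7 : r * |fderiv ℝ v x e * M₂| = ‖r * (fderiv ℝ v x e * M₂)‖ := by
      rw [norm_mul, Real.norm_of_nonneg hr.le, Real.norm_eq_abs]
    rw [h7, h6, ← mean_value hv hl 0 x r, ← integral_const_mul]
    refine norm_integral_le_of_norm_le ?_ (Eventually.of_forall fun y => ?_)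
    · exact (Pb_integrable (by fun_prop) 0).const_mul _
    · have hvp := hp (x + r • y)
      have hP := Pb_nonneg 1 y
      by_cases hy : 1 ≤ ‖y‖
      · simp [Pb_zero 0 y hy]
      · have h8 : |inner ℝ y e| ≤ ‖e‖ := by
          refine (abs_real_inner_le_norm y e).trans ?_
          nlinarith [norm_nonneg e]
        simp only [norm_mul, Real.norm_eq_abs, abs_of_pos hvp, zero_add, abs_of_nonneg hP]
        have : v (x + r • y) * Pb 1 y * |inner ℝ y e| ≤ v (x + r • y) * Pb 1 y * ‖e‖ :=
          mul_le_mul_of_nonneg_left h8 (by positivity)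
        norm_num
        nlinarith
  by_contra hne
  have hpos : 0 < |fderiv ℝ v x e * M₂| := abs_pos.2 (mul_ne_zero hne hM₂.ne')
  set A := 4 * ‖e‖ * (v x * M₁)
  have := key ((|A| + 1) / |fderiv ℝ v x e * M₂|) (by positivity)
  rw [div_mul_cancel₀ _ hpos.ne'] at this
  linarith [le_abs_self A]

lemma lap_inv {a : 𝔼 → ℝ} (ha : ContDiff ℝ 2 a) (hp : ∀ x, 0 < a x)
    (h : ∀ x, a x * lap a x = 2 * ‖gradient a x‖ ^ 2) (x : 𝔼) : lap (fun x => (a x)⁻¹) x = 0 := by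
  have had : Differentiable ℝ a := ha.differentiable (by simp)
  have hdd : Differentiable ℝ (fderiv ℝ a) := (ha.fderiv_right (m := 1) (by norm_num)).differentiable (by simp)
  have h1 : fderiv ℝ (fun x => (a x)⁻¹) = fun x => (-(a x ^ 2)⁻¹) • fderiv ℝ a x := by
    funext x
    exact ((hasDerivAt_inv (hp x).ne').comp_hasFDerivAt x (had x).hasFDerivAt).fderiv
  have h2 : ∀ e, fderiv ℝ (fderiv ℝ (fun x => (a x)⁻¹)) x e e =
      -(a x ^ 2)⁻¹ * fderiv ℝ (fderiv ℝ a) x e e + 2 * (a x ^ 3)⁻¹ * (fderiv ℝ a x e)^2 := by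
    intro e
    rw [h1]
    have g1 : HasDerivAt (fun t : ℝ => -(t ^ 2)⁻¹) (2 * (a x ^ 3)⁻¹) (a x) := by
      have := ((hasDerivAt_pow 2 (a x)).inv (pow_ne_zero 2 (hp x).ne')).neg
      refine HasDerivAt.congr_deriv (f := fun t : ℝ => -(t ^ 2)⁻¹) this ?_
      have := (hp x).ne'
      simp only [Nat.cast_ofNat]
      field_simp
      try norm_num
    have g2 := (g1.comp_hasFDerivAt x (had x).hasFDerivAt).smul (hdd x).hasFDerivAt
    have g3 : fderiv ℝ (fun x => (-(a x ^ 2)⁻¹) • fderiv ℝ a x) x = _ := g2.fderiv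
    rw [g3]
    simp
    ring
  unfold lap
  simp only [h2]
  rw [Finset.sum_add_distrib, ← Finset.mul_sum, ← Finset.mul_sum]
  have h3 : ∑ i, (fderiv ℝ a x (EuclideanSpace.single i 1))^2 = ‖gradient a x‖^2 := by
    rw [EuclideanSpace.norm_sq_eq]
    refine Finset.sum_congr rfl fun i _ => ?_
    rw [← inner_gradient_left, EuclideanSpace.inner_single_right]
    simp
  rw [h3]
  have h4 := h x
  unfold lap at h4
  have := (hp x).ne'
  field_simp
  linarith

lemma donaldson_eq (a b c : 𝔼 → ℝ)
    (ha : ContDiff ℝ 2 a) (hb : ContDiff ℝ 2 b) (hc : ContDiff ℝ 2 c) (t : ℝ) (x : 𝔼) :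
    donaldsonOp (fun p => a p.2 * p.1 ^ 2 + b p.2 * p.1 + c p.2) (t, x) =
      2 * a x * (t^2 * lap a x + t * lap b x + lap c x)
        - ((2*t)^2 * ‖gradient a x‖^2 + 2 * (2*t) * inner ℝ (gradient a x) (gradient b x) + ‖gradient b x‖^2) := by
  have had : Differentiable ℝ a := ha.differentiable (by simp)
  have hbd : Differentiable ℝ b := hb.differentiable (by simp)
  have hcd : Differentiable ℝ c := hc.differentiable (by simp)
  have hadd : Differentiable ℝ (fderiv ℝ a) := (ha.fderiv_right (m := 1) (by norm_num)).differentiable (by simp)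
  have hbdd : Differentiable ℝ (fderiv ℝ b) := (hb.fderiv_right (m := 1) (by norm_num)).differentiable (by simp)
  have hcdd : Differentiable ℝ (fderiv ℝ c) := (hc.fderiv_right (m := 1) (by norm_num)).differentiable (by simp)
  have e1 : ∀ q : ℝ × 𝔼, fderiv ℝ (fun p : ℝ × 𝔼 => a p.2 * p.1 ^ 2 + b p.2 * p.1 + c p.2) q (1, 0)
      = 2 * q.1 * a q.2 + b q.2 := by
    intro q
    rw [← DifferentiableAt.lineDeriv_eq_fderiv (by fun_prop)]
    unfold lineDeriv
    simp only [Prod.smul_mk, smul_zero, Prod.fst_add, Prod.snd_add, add_zero, smul_eq_mul, mul_one]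
    have h1 : HasDerivAt (fun s : ℝ => q.1 + s) 1 0 := (hasDerivAt_id 0).const_add _
    have h2 := (((h1.pow 2).const_mul (a q.2)).add (h1.const_mul (b q.2))).add_const (c q.2)
    refine HasDerivAt.deriv (h2.congr_deriv ?_)
    simp; ring
  have e2 : ∀ q : ℝ × 𝔼, fderiv ℝ (fun p : ℝ × 𝔼 => 2 * p.1 * a p.2 + b p.2) q (1, 0)
      = 2 * a q.2 := by
    intro q
    rw [← DifferentiableAt.lineDeriv_eq_fderiv (by fun_prop)]
    unfold lineDeriv
    simp only [Prod.smul_mk, smul_zero, Prod.fst_add, Prod.snd_add, add_zero, smul_eq_mul, mul_one]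
    have h1 : HasDerivAt (fun s : ℝ => q.1 + s) 1 0 := (hasDerivAt_id 0).const_add _
    have h2 := ((h1.const_mul 2).mul_const (a q.2)).add_const (b q.2)
    refine HasDerivAt.deriv (h2.congr_deriv ?_)
    simp
  have e3 : fderiv ℝ (fun y => a y * t ^ 2 + b y * t + c y) =
      fun y => t^2 • fderiv ℝ a y + t • fderiv ℝ b y + fderiv ℝ c y := by
    funext y
    exact ((((had y).hasFDerivAt.mul_const (t^2)).add ((hbd y).hasFDerivAt.mul_const t)).add
      (hcd y).hasFDerivAt).fderiv
  have e4 : fderiv ℝ (fun y => t^2 • fderiv ℝ a y + t • fderiv ℝ b y + fderiv ℝ c y) x =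
      t^2 • fderiv ℝ (fderiv ℝ a) x + t • fderiv ℝ (fderiv ℝ b) x + fderiv ℝ (fderiv ℝ c) x :=
    ((((hadd x).hasFDerivAt.const_smul (t^2)).add ((hbdd x).hasFDerivAt.const_smul t)).add
      (hcdd x).hasFDerivAt).fderiv
  have e5 : lap (fun y => a y * t ^ 2 + b y * t + c y) x = t^2 * lap a x + t * lap b x + lap c x := by
    unfold lap
    rw [e3, e4]
    simp [Finset.sum_add_distrib, Finset.mul_sum]
  have e6 : gradient (fun y => 2 * t * a y + b y) x = (2*t) • gradient a x + gradient b x := by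
    unfold gradient
    have : fderiv ℝ (fun y => 2 * t * a y + b y) x = (2*t) • fderiv ℝ a x + fderiv ℝ b x :=
      (((had x).hasFDerivAt.const_mul (2*t)).add (hbd x).hasFDerivAt).fderiv
    rw [this, map_add]
    congr 1
    simp
  unfold donaldsonOp
  simp only [e1, e2, e5, e6]
  rw [norm_add_sq_real, norm_smul, mul_pow, real_inner_smul_left]
  simp only [Real.norm_eq_abs, sq_abs]
  ring

end

/-- every entire solution of Donaldson's equation
`u_tt Δu − |∇u_t|² = 1` on `ℝ × ℝ^m` of the form `u(t,x) = a(x)t² + b(x)t + c(x)`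
has `a` constant, `Δb = 0` and `Δc = (|∇b|² + 1)/(2a)`. -/
theorem stmt13 {m : ℕ} (a b c : EuclideanSpace ℝ (Fin m) → ℝ)
    (ha : ContDiff ℝ (⊤ : ℕ∞) a) (hb : ContDiff ℝ (⊤ : ℕ∞) b)
    (hc : ContDiff ℝ (⊤ : ℕ∞) c) (hapos : ∀ x, 0 < a x)
    (u : ℝ × EuclideanSpace ℝ (Fin m) → ℝ)
    (hu : u = fun p => a p.2 * p.1 ^ 2 + b p.2 * p.1 + c p.2)
    (heq : ∀ p : ℝ × EuclideanSpace ℝ (Fin m), donaldsonOp u p = 1) :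
    (∃ a₀ : ℝ, ∀ x, a x = a₀) ∧
    (∀ x, lap b x = 0) ∧
    (∀ x, lap c x = (‖gradient b x‖ ^ 2 + 1) / (2 * a x)) := by
  have ha2 : ContDiff ℝ 2 a := ha.of_le (WithTop.coe_le_coe.2 (le_top : (2 : ℕ∞) ≤ ⊤))
  have hb2 : ContDiff ℝ 2 b := hb.of_le (WithTop.coe_le_coe.2 (le_top : (2 : ℕ∞) ≤ ⊤))
  have hc2 : ContDiff ℝ 2 c := hc.of_le (WithTop.coe_le_coe.2 (le_top : (2 : ℕ∞) ≤ ⊤))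
  subst hu
  have h0 := fun x => (donaldson_eq a b c ha2 hb2 hc2 0 x).symm.trans (heq (0, x))
  have h1 := fun x => (donaldson_eq a b c ha2 hb2 hc2 1 x).symm.trans (heq (1, x))
  have h2 := fun x => (donaldson_eq a b c ha2 hb2 hc2 (-1) x).symm.trans (heq (-1, x))
  have hA : ∀ x, a x * lap a x = 2 * ‖gradient a x‖ ^ 2 := by
    intro x
    linarith [h0 x, h1 x, h2 x]
  have hv : ContDiff ℝ 2 (fun x => (a x)⁻¹) := ha2.inv fun x => (hapos x).ne'
  have hconst : ∀ x, a x = a 0 := fun x =>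
    inv_injective (liouville_pos hv (lap_inv ha2 hapos hA) (fun x => inv_pos.2 (hapos x)) x 0)
  refine ⟨⟨a 0, hconst⟩, fun x => ?_, fun x => ?_⟩
  · have hg : gradient a x = 0 := by
      have : a = fun _ => a 0 := funext hconst
      rw [this]
      exact gradient_fun_const x (a 0)
    have h3 : a x * lap b x = 2 * inner ℝ (gradient a x) (gradient b x) := by
      linarith [h0 x, h1 x, h2 x]
    rw [hg, inner_zero_left, mul_zero] at h3
    exact (mul_eq_zero.1 h3).resolve_left (hapos x).ne'
  · rw [eq_div_iff (by have := hapos x; positivity)]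
    linarith [h0 x]
end
end

section
/- Let Ω ⊆ ℝ^m be a domain and let f ∈ C^∞(ℝ^m × ℝ) with f ≥ 0 and ∂f/∂u ≥ 0. If u is a weak solution of Δu = f(·,u) on Ω, then u agrees almost everywhere with a C^∞ function on Ω (which then solves Δu = f(·,u) classically on Ω). -/
open MeasureTheory

noncomputable section

/-- `u` is a weak solution of `Δu = g` on the open set `Ω`: `u, g ∈ L¹_loc(Ω)` and
`∫_Ω u Δφ = ∫_Ω g φ` for every test function `φ ∈ C_c^∞(Ω)`. -/
def IsWeakSol {m : ℕ} (u g : EuclideanSpace ℝ (Fin m) → ℝ)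
    (Ω : Set (EuclideanSpace ℝ (Fin m))) : Prop :=
  LocallyIntegrableOn u Ω ∧ LocallyIntegrableOn g Ω ∧
    ∀ φ : EuclideanSpace ℝ (Fin m) → ℝ,
      ContDiff ℝ (⊤ : ℕ∞) φ → HasCompactSupport φ → tsupport φ ⊆ Ω →
        ∫ x in Ω, u x * lap φ x = ∫ x in Ω, g x * φ x

section Helpers
open Set Filter Topology

section Kernel

variable {m : ℕ}

lemma param_hasFDerivAt {F : Type} [NormedAddCommGroup F] [NormedSpace ℝ F]
    (G : EuclideanSpace ℝ (Fin m) → F) (hG : ContDiff ℝ 1 G) (c : ℝ → ℝ) (hc : Continuous c)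
    (b : ℝ) (x₀ : EuclideanSpace ℝ (Fin m)) :
    HasFDerivAt (fun x => ∫ t in (0:ℝ)..b, c t • G (Real.exp t • x))
      (∫ t in (0:ℝ)..b, (c t * Real.exp t) • fderiv ℝ G (Real.exp t • x₀)) x₀ := by
  have hGc : Continuous G := hG.continuous
  have hG' : Continuous (fderiv ℝ G) := hG.continuous_fderiv one_ne_zero
  have hcont : Continuous (fun p : ℝ × EuclideanSpace ℝ (Fin m) =>
      (c p.1 * Real.exp p.1) • fderiv ℝ G (Real.exp p.1 • p.2)) := by fun_prop
  obtain ⟨C, hC⟩ := ((isCompact_uIcc (a := (0:ℝ)) (b := b)).prod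
    (isCompact_closedBall x₀ 1)).exists_bound_of_continuousOn hcont.continuousOn
  refine intervalIntegral.hasFDerivAt_integral_of_dominated_of_fderiv_le
    (F' := fun x t => (c t * Real.exp t) • fderiv ℝ G (Real.exp t • x))
    (bound := fun _ => C) (Metric.closedBall_mem_nhds x₀ one_pos) ?_ ?_ ?_ ?_ ?_ ?_
  · refine Eventually.of_forall fun x => ?_
    exact (by fun_prop : Continuous fun t => c t • G (Real.exp t • x)).aestronglyMeasurable
  · exact (by fun_prop : Continuous fun t => c t • G (Real.exp t • x₀)).intervalIntegrable _ _
  · exact (by fun_prop : Continuous fun t =>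
      (c t * Real.exp t) • fderiv ℝ G (Real.exp t • x₀)).aestronglyMeasurable
  · refine Eventually.of_forall fun t ht x hx => ?_
    exact hC (t, x) ⟨uIoc_subset_uIcc ht, hx⟩
  · exact intervalIntegrable_const
  · refine Eventually.of_forall fun t ht x hx => ?_
    have h1 : HasFDerivAt (fun x : EuclideanSpace ℝ (Fin m) => Real.exp t • x)
        (Real.exp t • ContinuousLinearMap.id ℝ _) x := by
      exact (hasFDerivAt_id x).const_smul (Real.exp t)
    have h2 := ((hG.differentiable one_ne_zero) (Real.exp t • x)).hasFDerivAt.comp x h1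
    have h3 := h2.const_smul (c t)
    refine h3.congr_fderiv ?_
    ext v
    simp [mul_smul]

lemma param_contDiff (n : ℕ) : ∀ {F : Type} [NormedAddCommGroup F] [NormedSpace ℝ F]
    (G : EuclideanSpace ℝ (Fin m) → F) (_ : ContDiff ℝ (⊤ : ℕ∞) G) (c : ℝ → ℝ)
    (_ : Continuous c) (b : ℝ),
    ContDiff ℝ n (fun x => ∫ t in (0:ℝ)..b, c t • G (Real.exp t • x)) := by
  induction n with
  | zero =>
    intro F _ _ G hG c hc b
    have := fun x => (param_hasFDerivAt G (hG.of_le (by simp)) c hc b x).continuousAt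
    exact contDiff_zero.2 (continuous_iff_continuousAt.2 this)
  | succ n ih =>
    intro F _ _ G hG c hc b
    have key := fun x => (param_hasFDerivAt G (hG.of_le (by simp)) c hc b x)
    push_cast
    rw [contDiff_succ_iff_fderiv]
    refine ⟨fun x => (key x).differentiableAt, by simp, ?_⟩
    have e : fderiv ℝ (fun x => ∫ t in (0:ℝ)..b, c t • G (Real.exp t • x)) = fun x =>
      ∫ t in (0:ℝ)..b, (c t * Real.exp t) • fderiv ℝ G (Real.exp t • x) :=
      funext fun x => (key x).fderiv
    rw [e]
    exact ih (fderiv ℝ G) (hG.fderiv_right (by simp)) _ (by fun_prop) b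

/-- the derivative of the glue function -/
def kk (r : ℝ) : ℝ := ((Polynomial.X : Polynomial ℝ) ^ 2).eval r⁻¹ * expNegInvGlue r

lemma glue_deriv (r : ℝ) : HasDerivAt expNegInvGlue (kk r) r := by
  have := expNegInvGlue.hasDerivAt_polynomial_eval_inv_mul 1 r
  simpa [kk] using this

lemma kk_contDiff {n : ℕ∞} : ContDiff ℝ n kk :=
  expNegInvGlue.contDiff_polynomial_eval_inv_mul _

lemma kk_nonneg (r : ℝ) : 0 ≤ kk r := by
  have := expNegInvGlue.nonneg r
  simp only [kk, Polynomial.eval_pow, Polynomial.eval_X]; positivity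

lemma kk_zero {r : ℝ} (h : r ≤ 0) : kk r = 0 := by
  simp [kk, expNegInvGlue.zero_of_nonpos h]

lemma kk_one : 0 < kk 1 := by
  have := expNegInvGlue.pos_of_pos one_pos
  simp [kk, this]

/-- potential -/
def Th (x : EuclideanSpace ℝ (Fin m)) : ℝ := expNegInvGlue (1 - ‖x‖ ^ 2)
/-- density -/
def et (x : EuclideanSpace ℝ (Fin m)) : ℝ := 2 * kk (1 - ‖x‖ ^ 2)

lemma Th_contDiff : ContDiff ℝ (⊤ : ℕ∞) (Th (m := m)) :=
  expNegInvGlue.contDiff.comp (contDiff_const.sub (contDiff_norm_sq ℝ))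

lemma et_contDiff : ContDiff ℝ (⊤ : ℕ∞) (et (m := m)) :=
  contDiff_const.mul (kk_contDiff.comp (contDiff_const.sub (contDiff_norm_sq ℝ)))

lemma Th_fderiv (x : EuclideanSpace ℝ (Fin m)) :
    HasFDerivAt Th (-(et x) • innerSL ℝ x) x := by
  have h1 : HasFDerivAt (fun x : EuclideanSpace ℝ (Fin m) => 1 - ‖x‖ ^ 2)
      (-(2 • innerSL ℝ x)) x := by
    simpa using (hasStrictFDerivAt_norm_sq x).hasFDerivAt.const_sub 1
  have := (glue_deriv (1 - ‖x‖^2)).comp_hasFDerivAt x h1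
  refine this.congr_fderiv ?_
  ext v
  simp [et]; ring

lemma lap_Th (y : EuclideanSpace ℝ (Fin m)) :
    lap Th y = - (m * et y + fderiv ℝ et y y) := by
  have e1 : fderiv ℝ (Th (m := m)) = fun x => -(et x) • innerSL ℝ x :=
    funext fun x => (Th_fderiv x).fderiv
  have het : HasFDerivAt (et (m := m)) (fderiv ℝ et y) y :=
    ((et_contDiff.differentiable (by simp)) y).hasFDerivAt
  have h2 := het.neg.smul (innerSL ℝ (E := EuclideanSpace ℝ (Fin m))).hasFDerivAt (x := y)
  have hy : y = ∑ i, y i • EuclideanSpace.single i (1:ℝ) := by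
    ext j; simp [Finset.sum_apply, Pi.single_apply]
  have h3 : fderiv ℝ et y y = ∑ i, y i * fderiv ℝ et y (EuclideanSpace.single i 1) := by
    conv_lhs => rw [show fderiv ℝ et y y = fderiv ℝ et y (∑ i, y i • EuclideanSpace.single i (1:ℝ)) from by rw [← hy]]
    simp [map_sum]
  rw [h3, lap, e1]
  erw [h2.fderiv]
  simp [Finset.sum_add_distrib]
  have i1 : ∀ i : Fin m, (innerSL ℝ (EuclideanSpace.single i (1:ℝ))) (EuclideanSpace.single i 1) =
      (1:ℝ) := fun i => by
    rw [innerSL_apply_apply]; simp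
  have i2 : ∀ i : Fin m, (innerSL ℝ y) (EuclideanSpace.single i 1) = y i := fun i => by
    rw [innerSL_apply_apply, real_inner_comm, EuclideanSpace.inner_single_left]; simp
  have s1 : ∑ i : Fin m, et y * (innerSL ℝ (EuclideanSpace.single i (1:ℝ)))
      (EuclideanSpace.single i 1) = m * et y := by
    simp [i1]
  have s2 : ∑ i : Fin m, (fderiv ℝ et y) (EuclideanSpace.single i 1) *
      (innerSL ℝ y) (EuclideanSpace.single i 1) =
      ∑ i : Fin m, y i * (fderiv ℝ et y) (EuclideanSpace.single i 1) := by
    refine Finset.sum_congr rfl fun i _ => ?_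
    rw [i2, mul_comm]
  erw [s1, s2]
  ring

lemma exists_kernel (m : ℕ) : ∃ η ψ : EuclideanSpace ℝ (Fin m) → ℝ,
    ContDiff ℝ (⊤ : ℕ∞) η ∧ ContDiff ℝ (⊤ : ℕ∞) ψ ∧ (∀ x, 1 ≤ ‖x‖ → η x = 0) ∧
    (∀ x, 1 ≤ ‖x‖ → ψ x = 0) ∧ (∀ x, 0 ≤ η x) ∧ (∀ x, 0 ≤ ψ x) ∧ ∫ x, η x = 1 ∧
    ∀ x, lap ψ x = η x - 2 ^ m * η ((2:ℝ) • x) := by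
  have etc : Continuous (et (m := m)) := et_contDiff.continuous
  have et0 : ∀ x : EuclideanSpace ℝ (Fin m), 1 ≤ ‖x‖ → et x = 0 := by
    intro x hx
    rw [et, kk_zero (by nlinarith), mul_zero]
  have Th0 : ∀ x : EuclideanSpace ℝ (Fin m), 1 ≤ ‖x‖ → Th x = 0 := by
    intro x hx
    rw [Th, expNegInvGlue.zero_of_nonpos (by nlinarith)]
  have etnn : ∀ x : EuclideanSpace ℝ (Fin m), 0 ≤ et x := fun x => by
    have := kk_nonneg (1 - ‖x‖ ^ 2)
    rw [et]; positivity
  have etcs : HasCompactSupport (et (m := m)) :=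
    HasCompactSupport.intro (isCompact_closedBall 0 1) fun x hx => et0 x (by
      simp at hx; exact hx.le)
  have hκ : 0 < ∫ x, et (m := m) x := by
    refine etc.integral_pos_of_hasCompactSupport_nonneg_nonzero etcs etnn (x := 0) ?_
    have := kk_one
    simp [et]; exact this.ne'
  set κ := ∫ x, et (m := m) x with hκd
  set c : ℝ → ℝ := fun t => κ⁻¹ * Real.exp ((m - 2) * t) with hc
  have hcc : Continuous c := by fun_prop
  refine ⟨fun x => κ⁻¹ * et x, fun x => ∫ t in (0:ℝ)..(Real.log 2), c t • Th (Real.exp t • x),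
    contDiff_const.mul et_contDiff, ?_, ?_, ?_, ?_, ?_, ?_, ?_⟩
  · exact contDiff_infty.2 fun n => param_contDiff n Th Th_contDiff c hcc _
  · intro x hx; simp [et0 x hx]
  · intro x hx
    beta_reduce
    rw [intervalIntegral.integral_congr (g := fun _ => (0:ℝ)) ?_]
    · simp
    intro t ht
    rw [uIcc_of_le (Real.log_nonneg one_le_two)] at ht
    have h1 : 1 ≤ Real.exp t := Real.one_le_exp ht.1
    simp only
    rw [Th0, smul_zero]
    rw [norm_smul, Real.norm_of_nonneg (by positivity)]
    nlinarith
  · intro x; exact mul_nonneg (inv_nonneg.2 hκ.le) (etnn x)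
  · intro x
    refine intervalIntegral.integral_nonneg (Real.log_nonneg one_le_two) fun t ht => ?_
    have := expNegInvGlue.nonneg (1 - ‖Real.exp t • x‖ ^ 2)
    exact mul_nonneg (mul_nonneg (inv_nonneg.2 hκ.le) (Real.exp_pos _).le) this
  · rw [integral_const_mul, ← hκd, inv_mul_cancel₀ hκ.ne']
  · intro x
    have e1 : fderiv ℝ (fun x : EuclideanSpace ℝ (Fin m) =>
        ∫ t in (0:ℝ)..(Real.log 2), c t • Th (Real.exp t • x)) = fun x =>
      ∫ t in (0:ℝ)..(Real.log 2), (c t * Real.exp t) • fderiv ℝ Th (Real.exp t • x) :=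
      funext fun x => (param_hasFDerivAt Th (Th_contDiff.of_le (by simp)) c hcc _ x).fderiv
    have hT1 : ContDiff ℝ (⊤ : ℕ∞) (fderiv ℝ (Th (m := m))) := Th_contDiff.fderiv_right (by simp)
    have hT2 : Continuous (fderiv ℝ (fderiv ℝ (Th (m := m)))) :=
      hT1.continuous_fderiv (by simp)
    have e2 := (param_hasFDerivAt (fderiv ℝ (Th (m := m))) (hT1.of_le (by simp))
      (fun t => c t * Real.exp t) (by fun_prop) (Real.log 2) x).fderiv
    have e3 : ∀ i, (∫ t in (0:ℝ)..(Real.log 2), (c t * Real.exp t * Real.exp t) •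
        fderiv ℝ (fderiv ℝ (Th (m := m))) (Real.exp t • x)) (EuclideanSpace.single i 1)
        (EuclideanSpace.single i 1) = ∫ t in (0:ℝ)..(Real.log 2),
        (c t * Real.exp t * Real.exp t) * fderiv ℝ (fderiv ℝ (Th (m := m))) (Real.exp t • x)
          (EuclideanSpace.single i 1) (EuclideanSpace.single i 1) := by
      intro i
      have i1 : Continuous (fun t => (c t * Real.exp t * Real.exp t) •
        fderiv ℝ (fderiv ℝ (Th (m := m))) (Real.exp t • x)) := by fun_prop
      have i2 : Continuous (fun t => ((c t * Real.exp t * Real.exp t) •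
        fderiv ℝ (fderiv ℝ (Th (m := m))) (Real.exp t • x)) (EuclideanSpace.single i 1)) := by
        fun_prop
      rw [ContinuousLinearMap.intervalIntegral_apply (i1.intervalIntegrable _ _),
        ContinuousLinearMap.intervalIntegral_apply (i2.intervalIntegrable _ _)]
      simp
    have hd : ∀ t : ℝ, HasDerivAt (fun t => - (κ⁻¹ * (Real.exp (m * t) * et (Real.exp t • x))))
        ((c t * Real.exp t * Real.exp t) * lap Th (Real.exp t • x)) t := by
      intro t
      have d1 : HasDerivAt (fun t : ℝ => Real.exp t • x) (Real.exp t • x) t :=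
        (Real.hasDerivAt_exp t).smul_const x
      have d2 := (((et_contDiff (m := m)).differentiable (by simp))
        (Real.exp t • x)).hasFDerivAt.comp_hasDerivAt t d1
      have d3 : HasDerivAt (fun t : ℝ => Real.exp (m * t)) (Real.exp (m * t) * (m * 1)) t :=
        ((hasDerivAt_id t).const_mul (m : ℝ)).exp
      have d4 := ((d3.mul d2).const_mul κ⁻¹).neg
      refine d4.congr_deriv ?_
      have : c t * Real.exp t * Real.exp t = κ⁻¹ * Real.exp (m * t) := by
        simp only [hc, mul_assoc, ← Real.exp_add]; ring_nf
      rw [lap_Th, this]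
      simp only [Function.comp]
      ring
    have hcl : Continuous (fun t => (c t * Real.exp t * Real.exp t) *
        lap (Th (m := m)) (Real.exp t • x)) := by
      unfold lap; fun_prop
    have ftc := intervalIntegral.integral_eq_sub_of_hasDerivAt (fun t _ => hd t)
      (hcl.intervalIntegrable 0 (Real.log 2))
    rw [lap, e1, e2, Finset.sum_congr rfl (fun i _ => e3 i),
      ← intervalIntegral.integral_finsetSum]
    · simp only [lap, Finset.mul_sum] at ftc
      rw [ftc, mul_comm (m:ℝ) (Real.log 2), Real.exp_mul, Real.exp_log two_pos]
      simp; ring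
    · intro i _
      exact (by fun_prop : Continuous _).intervalIntegrable _ _

end Kernel

section Scaling
variable {m : ℕ}

lemma fderiv_aff {F : Type} [NormedAddCommGroup F] [NormedSpace ℝ F]
    (G : EuclideanSpace ℝ (Fin m) → F) (hG : Differentiable ℝ G) (c a : ℝ)
    (b : EuclideanSpace ℝ (Fin m)) :
    fderiv ℝ (fun x => c • G (a • x + b)) = fun x => (c * a) • fderiv ℝ G (a • x + b) := by
  ext1 x
  have h1 : HasFDerivAt (fun x : EuclideanSpace ℝ (Fin m) => a • x + b)
      (a • ContinuousLinearMap.id ℝ _) x := by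
    exact ((hasFDerivAt_id x).const_smul a).add_const b
  have h2 := (hG (a • x + b)).hasFDerivAt.comp x h1
  have h3 := h2.const_smul c
  refine HasFDerivAt.fderiv (h3.congr_fderiv ?_)
  ext v
  simp [mul_smul]

lemma lap_aff (φ : EuclideanSpace ℝ (Fin m) → ℝ) (hφ : ContDiff ℝ (⊤ : ℕ∞) φ) (c a : ℝ)
    (b x : EuclideanSpace ℝ (Fin m)) :
    lap (fun x => c • φ (a • x + b)) x = c * a ^ 2 * lap φ (a • x + b) := by
  have h1 : ContDiff ℝ (⊤ : ℕ∞) (fderiv ℝ φ) := hφ.fderiv_right (by simp)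
  rw [lap, fderiv_aff φ (hφ.differentiable (by simp)),
    fderiv_aff _ (h1.differentiable (by simp)), lap, Finset.mul_sum]
  refine Finset.sum_congr rfl fun i _ => ?_
  simp only [smul_apply, smul_eq_mul]
  ring

/-- scaled density -/
def etaS (η : EuclideanSpace ℝ (Fin m) → ℝ) (a : ℝ) (x : EuclideanSpace ℝ (Fin m)) : ℝ :=
  a ^ m * η (a • x)
/-- scaled potential -/
def psiS (ψ : EuclideanSpace ℝ (Fin m) → ℝ) (a : ℝ) (x : EuclideanSpace ℝ (Fin m)) : ℝ :=
  a ^ m / a ^ 2 * ψ (a • x)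

lemma etaS_contDiff {η : EuclideanSpace ℝ (Fin m) → ℝ} (hη : ContDiff ℝ (⊤ : ℕ∞) η) (a : ℝ) :
    ContDiff ℝ (⊤ : ℕ∞) (etaS η a) :=
  contDiff_const.mul (hη.comp (contDiff_const_smul a))

lemma psiS_contDiff {η : EuclideanSpace ℝ (Fin m) → ℝ} (hη : ContDiff ℝ (⊤ : ℕ∞) η) (a : ℝ) :
    ContDiff ℝ (⊤ : ℕ∞) (psiS η a) :=
  contDiff_const.mul (hη.comp (contDiff_const_smul a))

lemma zero_scale {η : EuclideanSpace ℝ (Fin m) → ℝ} (h0 : ∀ x, 1 ≤ ‖x‖ → η x = 0) {a : ℝ}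
    (ha : 0 < a) (x : EuclideanSpace ℝ (Fin m)) (hx : 1 / a ≤ ‖x‖) : η (a • x) = 0 := by
  apply h0
  rw [norm_smul, Real.norm_of_nonneg ha.le]
  rwa [div_le_iff₀' ha] at hx

lemma etaS_zero {η : EuclideanSpace ℝ (Fin m) → ℝ} (h0 : ∀ x, 1 ≤ ‖x‖ → η x = 0) {a : ℝ}
    (ha : 0 < a) (x : EuclideanSpace ℝ (Fin m)) (hx : 1 / a ≤ ‖x‖) : etaS η a x = 0 := by
  rw [etaS, zero_scale h0 ha x hx, mul_zero]

lemma psiS_zero {η : EuclideanSpace ℝ (Fin m) → ℝ} (h0 : ∀ x, 1 ≤ ‖x‖ → η x = 0) {a : ℝ}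
    (ha : 0 < a) (x : EuclideanSpace ℝ (Fin m)) (hx : 1 / a ≤ ‖x‖) : psiS η a x = 0 := by
  rw [psiS, zero_scale h0 ha x hx, mul_zero]

lemma hcs_of_zero {η : EuclideanSpace ℝ (Fin m) → ℝ} {r : ℝ} (h0 : ∀ x, r ≤ ‖x‖ → η x = 0) :
    HasCompactSupport η :=
  HasCompactSupport.intro (isCompact_closedBall 0 r) fun x hx => h0 x (by
    simp at hx; exact hx.le)

lemma lap_psiS {η ψ : EuclideanSpace ℝ (Fin m) → ℝ} (hψ : ContDiff ℝ (⊤ : ℕ∞) ψ)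
    (hl : ∀ x, lap ψ x = η x - 2 ^ m * η ((2:ℝ) • x)) {a : ℝ} (ha : 0 < a)
    (x y : EuclideanSpace ℝ (Fin m)) :
    lap (fun y => psiS ψ a (x - y)) y = etaS η a (x - y) - etaS η (2 * a) (x - y) := by
  have e : (fun y => psiS ψ a (x - y)) = fun y => (a ^ m / a ^ 2) • ψ ((-a) • y + a • x) := by
    ext y
    simp only [psiS, smul_eq_mul]
    congr 2
    rw [smul_sub, neg_smul]; abel
  rw [e, lap_aff ψ hψ, hl]
  have e2 : (-a) • y + a • x = a • (x - y) := by rw [smul_sub, neg_smul]; abel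
  rw [e2, etaS, etaS, smul_smul, mul_pow]
  field_simp

lemma integral_scale {F : Type} [NormedAddCommGroup F] [NormedSpace ℝ F]
    (k : EuclideanSpace ℝ (Fin m) → F) {a : ℝ} (ha : 0 < a) :
    a ^ m * ∫ x, ‖k (a • x)‖ = ∫ x, ‖k x‖ := by
  have := Measure.integral_comp_smul (volume : Measure (EuclideanSpace ℝ (Fin m)))
    (fun x => ‖k x‖) a
  rw [this]
  simp only [finrank_euclideanSpace, Fintype.card_fin, smul_eq_mul]
  rw [abs_of_pos (by positivity), ← mul_assoc, mul_inv_cancel₀ (by positivity), one_mul]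

lemma psiS_norm (ψ : EuclideanSpace ℝ (Fin m) → ℝ) {a : ℝ} (ha : 0 < a) :
    ∫ x, ‖psiS ψ a x‖ = (1 / a ^ 2) * ∫ x, ‖ψ x‖ := by
  rw [← integral_scale ψ ha]
  simp only [psiS, norm_mul]
  rw [integral_const_mul, Real.norm_of_nonneg (by positivity)]
  ring

lemma psiS_fderiv_norm {ψ : EuclideanSpace ℝ (Fin m) → ℝ} (hψ : ContDiff ℝ (⊤ : ℕ∞) ψ)
    {a : ℝ} (ha : 0 < a) :
    ∫ x, ‖fderiv ℝ (psiS ψ a) x‖ = (1 / a) * ∫ x, ‖fderiv ℝ ψ x‖ := by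
  rw [← integral_scale (fderiv ℝ ψ) ha]
  have := fderiv_aff ψ (hψ.differentiable (by simp)) (a ^ m / a ^ 2) a 0
  simp only [add_zero, smul_eq_mul] at this
  have e : fderiv ℝ (psiS ψ a) = _ := this
  rw [e]
  simp only [norm_smul]
  rw [integral_const_mul, Real.norm_of_nonneg (by positivity)]
  field_simp

lemma etaS_tendsto {η : EuclideanSpace ℝ (Fin m) → ℝ} (hη : ContDiff ℝ (⊤ : ℕ∞) η)
    (h0 : ∀ x, 1 ≤ ‖x‖ → η x = 0) (hn : ∀ x, 0 ≤ η x) (hi : ∫ x, η x = 1) {a : ℝ} (ha : 0 < a)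
    {U : EuclideanSpace ℝ (Fin m) → ℝ} (hU : Integrable U) :
    ∀ᵐ x, Tendsto (fun j : ℕ => ∫ y, etaS η (a * 2 ^ j) (x - y) * U y) atTop (𝓝 (U x)) := by
  have hpos : ∀ j : ℕ, 0 < a * 2 ^ j := fun j => by positivity
  obtain ⟨C, hC⟩ := (hcs_of_zero h0).exists_bound_of_continuous hη.continuous
  filter_upwards [(Besicovitch.vitaliFamily (volume : Measure
    (EuclideanSpace ℝ (Fin m)))).ae_tendsto_average_norm_sub hU.locallyIntegrable] with x hx
  have hlim : Tendsto (fun j : ℕ => 1 / (a * 2 ^ j)) atTop (𝓝[>] 0) := by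
    refine tendsto_nhdsWithin_iff.2 ⟨?_, Eventually.of_forall fun j => by
      have := hpos j; simp only [mem_Ioi]; positivity⟩
    have h1 : Tendsto (fun j : ℕ => a * (2:ℝ) ^ j) atTop atTop :=
      (tendsto_pow_atTop_atTop_of_one_lt one_lt_two).const_mul_atTop ha
    simp only [one_div]
    exact h1.inv_tendsto_atTop
  have := (hx.comp (Besicovitch.tendsto_filterAt volume x)).comp hlim
  refine tendsto_integral_smul_of_tendsto_average_norm_sub
    (C * (volume : Measure (EuclideanSpace ℝ (Fin m))).real (Metric.closedBall 0 1)) this ?_ ?_ ?_ ?_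
  · exact Eventually.of_forall fun j => hU.integrableOn
  · refine tendsto_const_nhds.congr fun j => ?_
    rw [integral_sub_left_eq_self (etaS η (a * 2 ^ j)) volume x]
    have e := integral_scale η (hpos j)
    simp only [Real.norm_of_nonneg (hn _), hi] at e
    rw [← e, ← integral_const_mul]; rfl
  · refine Eventually.of_forall fun j y hy => ?_
    by_contra hcon
    refine hy (etaS_zero h0 (hpos j) _ ?_)
    simp only [Metric.mem_closedBall, not_le] at hcon
    rw [dist_comm, dist_eq_norm] at hcon
    exact hcon.le
  · refine Eventually.of_forall fun j y => ?_
    have hj := hpos j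
    simp only
    rw [Measure.addHaar_real_closedBall _ x (by positivity), finrank_euclideanSpace_fin]
    have hv : 0 < (volume : Measure (EuclideanSpace ℝ (Fin m))).real (Metric.ball 0 1) :=
      ENNReal.toReal_pos (Metric.measure_ball_pos _ _ one_pos).ne' measure_ball_lt_top.ne
    have hv2 : (volume : Measure (EuclideanSpace ℝ (Fin m))).real (Metric.closedBall 0 1) =
       (volume : Measure (EuclideanSpace ℝ (Fin m))).real (Metric.ball 0 1) := by
      rw [Measure.addHaar_real_closedBall _ _ (by positivity)]; simp
    rw [hv2, etaS, abs_mul, abs_of_pos (by positivity)]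
    have h4 := hC ((a * 2 ^ j) • (x - y))
    rw [Real.norm_eq_abs] at h4
    rw [le_div_iff₀ (by positivity)]
    calc _ = |η ((a * 2 ^ j) • (x - y))| * (volume : Measure (EuclideanSpace ℝ (Fin m))).real (Metric.ball 0 1) := by
            rw [one_div, inv_pow]; field_simp
      _ ≤ _ := by gcongr

end Scaling

section Rep
variable {m : ℕ}

lemma etaS_int {η : EuclideanSpace ℝ (Fin m) → ℝ} (hη : ContDiff ℝ (⊤ : ℕ∞) η)
    (h0 : ∀ x, 1 ≤ ‖x‖ → η x = 0) {a : ℝ} (ha : 0 < a)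
    {U : EuclideanSpace ℝ (Fin m) → ℝ} (hU : Integrable U) (x : EuclideanSpace ℝ (Fin m)) :
    Integrable (fun y => etaS η a (x - y) * U y) := by
  obtain ⟨C, hC⟩ := (hcs_of_zero (etaS_zero h0 ha)).exists_bound_of_continuous
    (etaS_contDiff hη a).continuous
  refine hU.bdd_mul (c := C) ?_ (Eventually.of_forall fun y => hC _)
  exact ((etaS_contDiff hη a).continuous.comp (by fun_prop)).aestronglyMeasurable

lemma step {η ψ : EuclideanSpace ℝ (Fin m) → ℝ} (hη : ContDiff ℝ (⊤ : ℕ∞) η)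
    (hψ : ContDiff ℝ (⊤ : ℕ∞) ψ) (h0 : ∀ x, 1 ≤ ‖x‖ → η x = 0) (h0' : ∀ x, 1 ≤ ‖x‖ → ψ x = 0)
    (hl : ∀ x, lap ψ x = η x - 2 ^ m * η ((2:ℝ) • x))
    {u g H : EuclideanSpace ℝ (Fin m) → ℝ} {Ω : Set (EuclideanSpace ℝ (Fin m))}
    (hw : IsWeakSol u g Ω) {x₀ : EuclideanSpace ℝ (Fin m)} {R : ℝ} (hR : 0 < R)
    (hball : Metric.closedBall x₀ (3 * R) ⊆ Ω)
    (hH : ∀ᵐ y, y ∈ Metric.ball x₀ (2 * R) → H y = g y)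
    {a : ℝ} (ha : 0 < a) (haR : 1 / a ≤ R) {x : EuclideanSpace ℝ (Fin m)}
    (hx : x ∈ Metric.ball x₀ R) :
    (∫ y, etaS η a (x - y) * (Metric.closedBall x₀ (3 * R)).indicator u y) -
    (∫ y, etaS η (2 * a) (x - y) * (Metric.closedBall x₀ (3 * R)).indicator u y) =
    ∫ y, psiS ψ a (x - y) * H y := by
  have hU : Integrable ((Metric.closedBall x₀ (3 * R)).indicator u) :=
    (integrable_indicator_iff Metric.isClosed_closedBall.measurableSet).2
      (hw.1.integrableOn_compact_subset hball (isCompact_closedBall _ _))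
  have hfar : ∀ y, y ∉ Metric.ball x₀ (2 * R) → R ≤ ‖x - y‖ := by
    intro y hy
    simp only [Metric.mem_ball, not_lt] at hx hy
    rw [← dist_eq_norm]
    have := dist_triangle y x x₀
    rw [dist_comm y x] at this
    linarith
  have h2a : 1 / (2 * a) ≤ R := le_trans (by
    apply one_div_le_one_div_of_le ha; linarith) haR
  rw [← integral_sub (etaS_int hη h0 ha hU x) (etaS_int hη h0 (by positivity) hU x)]
  have hsm : ContDiff ℝ (⊤ : ℕ∞) (fun y => psiS ψ a (x - y)) :=
    (psiS_contDiff hψ a).comp (contDiff_const.sub contDiff_id)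
  have hz : ∀ y, y ∉ Metric.ball x₀ (2 * R) → psiS ψ a (x - y) = 0 := fun y hy =>
    psiS_zero h0' ha _ (haR.trans (hfar y hy))
  have hts : tsupport (fun y => psiS ψ a (x - y)) ⊆ Metric.closedBall x₀ (2 * R) := by
    refine closure_minimal ?_ Metric.isClosed_closedBall
    intro y hy
    by_contra hcon
    exact hy (hz y fun h => hcon (Metric.ball_subset_closedBall h))
  have hb23 : Metric.closedBall x₀ (2 * R) ⊆ Metric.closedBall x₀ (3 * R) :=
    Metric.closedBall_subset_closedBall (by linarith)
  have hcs : HasCompactSupport (fun y => psiS ψ a (x - y)) :=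
    (isCompact_closedBall x₀ (2 * R)).of_isClosed_subset (isClosed_tsupport _) hts
  have key := hw.2.2 _ hsm hcs (hts.trans (hb23.trans hball))
  have e1 : ∀ y, y ∉ Metric.ball x₀ (2 * R) → lap (fun y => psiS ψ a (x - y)) y = 0 := by
    intro y hy
    rw [lap_psiS hψ hl ha, etaS_zero h0 ha _ (haR.trans (hfar y hy)),
      etaS_zero h0 (by positivity) _ (h2a.trans (hfar y hy)), sub_zero]
  have hbΩ : ∀ y, y ∉ Ω → y ∉ Metric.ball x₀ (2 * R) := fun y hy h =>
    hy (hball (hb23 (Metric.ball_subset_closedBall h)))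
  rw [setIntegral_eq_integral_of_forall_compl_eq_zero (fun y hy => by
      rw [e1 y (hbΩ y hy), mul_zero]),
    setIntegral_eq_integral_of_forall_compl_eq_zero (fun y hy => by
      rw [hz y (hbΩ y hy), mul_zero])] at key
  calc _ = ∫ y, u y * lap (fun y => psiS ψ a (x - y)) y := by
        congr 1; ext y
        by_cases hy : y ∈ Metric.ball x₀ (2 * R)
        · rw [indicator_of_mem (hb23 (Metric.ball_subset_closedBall hy)), lap_psiS hψ hl ha]; ring
        · rw [← sub_mul, ← lap_psiS hψ hl ha, e1 y hy]; ring
    _ = _ := key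
    _ = _ := by
        refine integral_congr_ae ?_
        filter_upwards [hH] with y hy
        by_cases h : y ∈ Metric.ball x₀ (2 * R)
        · rw [hy h, mul_comm]
        · simp only [hz y h, mul_zero, zero_mul]

lemma rep {η ψ : EuclideanSpace ℝ (Fin m) → ℝ} (hη : ContDiff ℝ (⊤ : ℕ∞) η)
    (hψ : ContDiff ℝ (⊤ : ℕ∞) ψ) (h0 : ∀ x, 1 ≤ ‖x‖ → η x = 0) (h0' : ∀ x, 1 ≤ ‖x‖ → ψ x = 0)
    (hn : ∀ x, 0 ≤ η x) (hi : ∫ x, η x = 1)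
    (hl : ∀ x, lap ψ x = η x - 2 ^ m * η ((2:ℝ) • x))
    {u g H : EuclideanSpace ℝ (Fin m) → ℝ} {Ω : Set (EuclideanSpace ℝ (Fin m))}
    (hw : IsWeakSol u g Ω) {x₀ : EuclideanSpace ℝ (Fin m)} {R : ℝ} (hR : 0 < R)
    (hball : Metric.closedBall x₀ (3 * R) ⊆ Ω)
    (hH : ∀ᵐ y, y ∈ Metric.ball x₀ (2 * R) → H y = g y) :
    ∀ᵐ x, x ∈ Metric.ball x₀ R → Tendsto (fun N : ℕ =>
      (∫ y, etaS η (1 / R) (x - y) * (Metric.closedBall x₀ (3 * R)).indicator u y) -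
      ∑ j ∈ Finset.range N, ∫ y, psiS ψ (1 / R * 2 ^ j) (x - y) * H y) atTop (𝓝 (u x)) := by
  have hU : Integrable ((Metric.closedBall x₀ (3 * R)).indicator u) :=
    (integrable_indicator_iff Metric.isClosed_closedBall.measurableSet).2
      (hw.1.integrableOn_compact_subset hball (isCompact_closedBall _ _))
  filter_upwards [etaS_tendsto hη h0 hn hi (a := 1 / R) (by positivity) hU] with x hx hxb
  have hm : x ∈ Metric.closedBall x₀ (3 * R) :=
    Metric.closedBall_subset_closedBall (by linarith) (Metric.ball_subset_closedBall hxb)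
  rw [indicator_of_mem hm] at hx
  refine hx.congr fun N => ?_
  have hs : ∀ j : ℕ, ∫ y, psiS ψ (1 / R * 2 ^ j) (x - y) * H y = _ := fun j =>
    (step hη hψ h0 h0' hl hw hR hball hH (a := 1 / R * 2 ^ j) (by positivity) (by
      rw [one_div_le (by positivity) hR]
      have : (1:ℝ) ≤ 2 ^ j := one_le_pow₀ one_le_two
      have : 0 < 1 / R := by positivity
      nlinarith) hxb).symm
  have hs' : ∀ j : ℕ, 2 * (1 / R * 2 ^ j) = 1 / R * 2 ^ (j + 1) := fun j => by ring
  simp only [hs, hs']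
  rw [Finset.sum_range_sub']
  simp

end Rep

section Sums
variable {m : ℕ}
open ContinuousLinearMap Convolution

lemma conv_bound {F A B : Type} [NormedAddCommGroup F] [NormedSpace ℝ F]
    [NormedAddCommGroup A] [NormedSpace ℝ A] [NormedAddCommGroup B] [NormedSpace ℝ B]
    (L : A →L[ℝ] F →L[ℝ] B) (hL : ∀ p q, ‖L p q‖ ≤ ‖p‖ * ‖q‖)
    {k : EuclideanSpace ℝ (Fin m) → A} (hk : Integrable k) {H : EuclideanSpace ℝ (Fin m) → F}
    {C : ℝ} (hC : ∀ x, ‖H x‖ ≤ C) (x : EuclideanSpace ℝ (Fin m)) :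
    ‖(k ⋆[L, volume] H) x‖ ≤ (∫ y, ‖k y‖) * C := by
  rw [convolution, ← integral_mul_const]
  refine norm_integral_le_of_norm_le (hk.norm.mul_const C) (Eventually.of_forall fun y => ?_)
  exact (hL _ _).trans (mul_le_mul_of_nonneg_left (hC _) (norm_nonneg _))

lemma lsmul_bd {F : Type} [NormedAddCommGroup F] [NormedSpace ℝ F] (p : ℝ) (q : F) :
    ‖(lsmul ℝ ℝ : ℝ →L[ℝ] F →L[ℝ] F) p q‖ ≤ ‖p‖ * ‖q‖ := by
  simp [norm_smul]

lemma precompL_bd {F : Type} [NormedAddCommGroup F] [NormedSpace ℝ F]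
    (p : EuclideanSpace ℝ (Fin m) →L[ℝ] ℝ) (q : F) :
    ‖((lsmul ℝ ℝ : ℝ →L[ℝ] F →L[ℝ] F).precompL (EuclideanSpace ℝ (Fin m))) p q‖ ≤ ‖p‖ * ‖q‖ := by
  refine opNorm_le_bound _ (by positivity) fun v => ?_
  simp only [precompL_apply, lsmul_apply, norm_smul]
  calc ‖p v‖ * ‖q‖ ≤ (‖p‖ * ‖v‖) * ‖q‖ := by gcongr; exact p.le_opNorm v
    _ = _ := by ring

variable {ψ : EuclideanSpace ℝ (Fin m) → ℝ} (hψ : ContDiff ℝ (⊤ : ℕ∞) ψ)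
  (h0 : ∀ x, 1 ≤ ‖x‖ → ψ x = 0) {a : ℝ} (ha : 0 < a)

lemma sum_geo (ha : 0 < a) (C : ℝ) : Summable fun j : ℕ => 1 / (a * 2 ^ j) * C := by
  have : Summable fun j : ℕ => ((1:ℝ) / 2) ^ j := summable_geometric_two
  refine ((this.mul_left (1 / a)).mul_right C).congr fun j => ?_
  rw [one_div_pow]; field_simp

lemma sum_geo2 (ha : 0 < a) (C : ℝ) : Summable fun j : ℕ => 1 / (a * 2 ^ j) ^ 2 * C := by
  have : Summable fun j : ℕ => ((1:ℝ) / 4) ^ j :=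
    summable_geometric_of_lt_one (by norm_num) (by norm_num)
  refine ((this.mul_left (1 / a ^ 2)).mul_right C).congr fun j => ?_
  rw [one_div_pow, mul_pow, ← pow_mul, mul_comm j 2, pow_mul, show (2:ℝ) ^ 2 = 4 by norm_num]; field_simp

include hψ h0 ha

lemma psiS_integrable : Integrable (psiS ψ a) :=
  (psiS_contDiff hψ a).continuous.integrable_of_hasCompactSupport (hcs_of_zero (psiS_zero h0 ha))

lemma psiS_fderiv_integrable : Integrable (fderiv ℝ (psiS ψ a)) :=
  ((psiS_contDiff hψ a).continuous_fderiv (by simp)).integrable_of_hasCompactSupport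
    ((hcs_of_zero (psiS_zero h0 ha)).fderiv ℝ)

lemma S_bound {F : Type} [NormedAddCommGroup F] [NormedSpace ℝ F]
    {H : EuclideanSpace ℝ (Fin m) → F} {C : ℝ} (hC : ∀ x, ‖H x‖ ≤ C) (j : ℕ)
    (x : EuclideanSpace ℝ (Fin m)) :
    ‖(psiS ψ (a * 2 ^ j) ⋆[lsmul ℝ ℝ, volume] H) x‖ ≤
      1 / (a * 2 ^ j) ^ 2 * ((∫ x, ‖ψ x‖) * C) := by
  have hj : 0 < a * 2 ^ j := by positivity
  refine (conv_bound _ lsmul_bd (psiS_integrable hψ h0 hj) hC x).trans_eq ?_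
  rw [psiS_norm ψ hj]; ring

lemma S_summable {F : Type} [NormedAddCommGroup F] [NormedSpace ℝ F] [CompleteSpace F]
    {H : EuclideanSpace ℝ (Fin m) → F} {C : ℝ} (hC : ∀ x, ‖H x‖ ≤ C)
    (x : EuclideanSpace ℝ (Fin m)) :
    Summable fun j : ℕ => (psiS ψ (a * 2 ^ j) ⋆[lsmul ℝ ℝ, volume] H) x :=
  Summable.of_norm_bounded (sum_geo2 ha _) fun j => S_bound hψ h0 ha hC j x

lemma S_zero {F : Type} [NormedAddCommGroup F] [NormedSpace ℝ F] [CompleteSpace F]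
    {H : EuclideanSpace ℝ (Fin m) → F} {C : ℝ} (hC : ∀ x, ‖H x‖ ≤ C)
    (hH : LocallyIntegrable H) :
    ContDiff ℝ 1 fun x => ∑' j : ℕ, (psiS ψ (a * 2 ^ j) ⋆[lsmul ℝ ℝ, volume] H) x := by
  have hj : ∀ j : ℕ, 0 < a * 2 ^ j := fun j => by positivity
  have hd : ∀ (j : ℕ) x, HasFDerivAt (psiS ψ (a * 2 ^ j) ⋆[lsmul ℝ ℝ, volume] H)
      ((fderiv ℝ (psiS ψ (a * 2 ^ j)) ⋆[(lsmul ℝ ℝ).precompL _, volume] H) x) x := fun j x =>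
    (hcs_of_zero (psiS_zero h0 (hj j))).hasFDerivAt_convolution_left _
      ((psiS_contDiff hψ _).of_le (by simp)) hH x
  have hb : ∀ (j : ℕ) x, ‖(fderiv ℝ (psiS ψ (a * 2 ^ j)) ⋆[(lsmul ℝ ℝ).precompL _, volume] H) x‖ ≤
      1 / (a * 2 ^ j) * ((∫ x, ‖fderiv ℝ ψ x‖) * C) := fun j x => by
    refine (conv_bound _ precompL_bd (psiS_fderiv_integrable hψ h0 (hj j)) hC x).trans_eq ?_
    rw [psiS_fderiv_norm hψ (hj j)]; ring
  have key := fun x => hasFDerivAt_tsum (sum_geo ha _) hd hb (S_summable hψ h0 ha hC 0) x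
  rw [contDiff_one_iff_fderiv]
  refine ⟨fun x => (key x).differentiableAt, ?_⟩
  rw [show fderiv ℝ _ = _ from funext fun x => (key x).fderiv]
  refine continuous_tsum (fun j => ?_) (sum_geo ha _) hb
  exact ((hcs_of_zero (psiS_zero h0 (hj j))).fderiv ℝ).continuous_convolution_left _
    ((psiS_contDiff hψ _).continuous_fderiv (by simp)) hH

lemma S_succ (n : ℕ) : ∀ {F : Type} [NormedAddCommGroup F] [NormedSpace ℝ F] [CompleteSpace F]
    {H : EuclideanSpace ℝ (Fin m) → F} (_ : ContDiff ℝ n H) (_ : HasCompactSupport H),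
    ContDiff ℝ (n + 1) fun x => ∑' j : ℕ, (psiS ψ (a * 2 ^ j) ⋆[lsmul ℝ ℝ, volume] H) x := by
  induction n with
  | zero =>
    intro F _ _ _ H hH hHc
    obtain ⟨C, hC⟩ := hHc.exists_bound_of_continuous hH.continuous
    simpa using S_zero hψ h0 ha hC hH.continuous.locallyIntegrable
  | succ n ih =>
    intro F _ _ _ H hH hHc
    have hj : ∀ j : ℕ, 0 < a * 2 ^ j := fun j => by positivity
    have hH1 : ContDiff ℝ 1 H := hH.of_le (by simp)
    obtain ⟨C, hC⟩ := hHc.exists_bound_of_continuous hH.continuous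
    have hH' : ContDiff ℝ n (fderiv ℝ H) := hH.fderiv_right (by simp)
    have hHc' : HasCompactSupport (fderiv ℝ H) := hHc.fderiv ℝ
    obtain ⟨C', hC'⟩ := hHc'.exists_bound_of_continuous hH'.continuous
    have hd : ∀ (j : ℕ) x, HasFDerivAt (psiS ψ (a * 2 ^ j) ⋆[lsmul ℝ ℝ, volume] H)
        ((psiS ψ (a * 2 ^ j) ⋆[lsmul ℝ ℝ, volume] (fderiv ℝ H)) x) x := fun j x => by
      have := hHc.hasFDerivAt_convolution_right (lsmul ℝ ℝ : ℝ →L[ℝ] F →L[ℝ] F)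
        (psiS_integrable hψ h0 (hj j)).locallyIntegrable hH1 x
      refine this.congr_fderiv ?_
      simp only [convolution]
      congr 1
    have key := fun x => hasFDerivAt_tsum (sum_geo2 ha _) hd
      (fun j x => S_bound hψ h0 ha hC' j x) (S_summable hψ h0 ha hC 0) x
    rw [contDiff_succ_iff_fderiv]
    refine ⟨fun x => (key x).differentiableAt, by simp, ?_⟩
    rw [show fderiv ℝ _ = _ from funext fun x => (key x).fderiv]
    push_cast
    exact ih hH' hHc'

end Sums

section Final
variable {m : ℕ}
open ContinuousLinearMap Convolution

lemma lap_symm {w φ : EuclideanSpace ℝ (Fin m) → ℝ} (hw : ContDiff ℝ (⊤ : ℕ∞) w)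
    (hφ : ContDiff ℝ (⊤ : ℕ∞) φ) (hc : HasCompactSupport φ) :
    ∫ x, w x * lap φ x = ∫ x, lap w x * φ x := by
  have hd : ∀ {k : EuclideanSpace ℝ (Fin m) → ℝ}, ContDiff ℝ (⊤ : ℕ∞) k → ∀ v : EuclideanSpace ℝ (Fin m),
      ContDiff ℝ (⊤ : ℕ∞) (fun x => fderiv ℝ k x v) := fun hk v =>
    (hk.fderiv_right (m := (⊤ : ℕ∞)) (by simp)).clm_apply contDiff_const
  have hdd : ∀ {k : EuclideanSpace ℝ (Fin m) → ℝ}, ContDiff ℝ (⊤ : ℕ∞) k →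
      ∀ x v : EuclideanSpace ℝ (Fin m),
      fderiv ℝ (fderiv ℝ k) x v v = fderiv ℝ (fun x => fderiv ℝ k x v) x v := fun hk x v => by
    have h1 : DifferentiableAt ℝ (fderiv ℝ _) x :=
      ((hk.fderiv_right (m := (⊤ : ℕ∞)) (by simp)).differentiable (by simp)) x
    rw [fderiv_clm_apply h1 (differentiableAt_const v)]
    simp
  have hcd : ∀ v, HasCompactSupport (fun x => fderiv ℝ φ x v) := fun v => hc.fderiv_apply ℝ v
  have hcdd : ∀ v, HasCompactSupport (fun x => fderiv ℝ (fun x => fderiv ℝ φ x v) x v) :=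
    fun v => (hcd v).fderiv_apply ℝ v
  have key : ∀ v : EuclideanSpace ℝ (Fin m),
      ∫ x, w x * fderiv ℝ (fderiv ℝ φ) x v v = ∫ x, fderiv ℝ (fderiv ℝ w) x v v * φ x := by
    intro v
    simp only [hdd hw, hdd hφ]
    have c1 := (hd hw v).continuous
    have c2 := (hd hφ v).continuous
    have c3 := (hd (hd hφ v) v).continuous
    have c4 := (hd (hd hw v) v).continuous
    have c5 := hw.continuous
    have c6 := hφ.continuous
    rw [integral_mul_fderiv_eq_neg_fderiv_mul_of_integrable
      ((c1.mul c2).integrable_of_hasCompactSupport (hcd v).mul_left)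
      ((c5.mul c3).integrable_of_hasCompactSupport (hcdd v).mul_left)
      ((c5.mul c2).integrable_of_hasCompactSupport (hcd v).mul_left)
      (fun x _ => hw.differentiable (by simp) x) (fun x _ => (hd hφ v).differentiable (by simp) x),
      integral_mul_fderiv_eq_neg_fderiv_mul_of_integrable
      ((c4.mul c6).integrable_of_hasCompactSupport hc.mul_left)
      ((c1.mul c2).integrable_of_hasCompactSupport (hcd v).mul_left)
      ((c1.mul c6).integrable_of_hasCompactSupport hc.mul_left)
      (fun x _ => (hd hw v).differentiable (by simp) x) (fun x _ => hφ.differentiable (by simp) x),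
      neg_neg]
  simp only [lap, Finset.mul_sum, Finset.sum_mul]
  rw [integral_finset_sum, integral_finset_sum]
  · exact Finset.sum_congr rfl fun i _ => key _
  · intro i _
    simp only [hdd hw]
    exact ((hd (hd hw _) _).continuous.mul hφ.continuous).integrable_of_hasCompactSupport hc.mul_left
  · intro i _
    simp only [hdd hφ]
    exact (hw.continuous.mul (hd (hd hφ _) _).continuous).integrable_of_hasCompactSupport
      (hcdd _).mul_left

lemma upper_bound {u g : EuclideanSpace ℝ (Fin m) → ℝ} {Ω : Set (EuclideanSpace ℝ (Fin m))}
    (hw : IsWeakSol u g Ω) (hg : ∀ x, 0 ≤ g x) {x₀ : EuclideanSpace ℝ (Fin m)} {R : ℝ} (hR : 0 < R)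
    (hball : Metric.closedBall x₀ (3 * R) ⊆ Ω) :
    ∃ C, ∀ᵐ x, x ∈ Metric.ball x₀ R → u x ≤ C := by
  obtain ⟨η, ψ, hη, hψ, h0, h0', hn, hn', hi, hl⟩ := exists_kernel m
  have hU : Integrable ((Metric.closedBall x₀ (3 * R)).indicator u) :=
    (integrable_indicator_iff Metric.isClosed_closedBall.measurableSet).2
      (hw.1.integrableOn_compact_subset hball (isCompact_closedBall _ _))
  have ha : 0 < 1 / R := by positivity
  obtain ⟨C, hC⟩ := (hcs_of_zero (etaS_zero h0 ha)).exists_bound_of_continuous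
    (etaS_contDiff hη (1 / R)).continuous
  refine ⟨C * ∫ y, ‖(Metric.closedBall x₀ (3 * R)).indicator u y‖, ?_⟩
  filter_upwards [rep hη hψ h0 h0' hn hi hl hw hR hball (H := g)
    (Eventually.of_forall fun y _ => rfl)] with x hx hxb
  refine le_of_tendsto' (hx hxb) fun N => ?_
  have h1 : 0 ≤ ∑ j ∈ Finset.range N, ∫ y, psiS ψ (1 / R * 2 ^ j) (x - y) * g y :=
    Finset.sum_nonneg fun j _ => integral_nonneg fun y => mul_nonneg
      (mul_nonneg (by positivity) (hn' _)) (hg _)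
  have h2 : ∫ y, etaS η (1 / R) (x - y) * (Metric.closedBall x₀ (3 * R)).indicator u y ≤
      C * ∫ y, ‖(Metric.closedBall x₀ (3 * R)).indicator u y‖ := by
    rw [← integral_const_mul]
    refine (Real.le_norm_self _).trans (norm_integral_le_of_norm_le (hU.norm.const_mul C)
      (Eventually.of_forall fun y => ?_))
    rw [norm_mul]
    exact mul_le_mul_of_nonneg_right (hC _) (norm_nonneg _)
  linarith

lemma local_rep {u g H : EuclideanSpace ℝ (Fin m) → ℝ} {Ω : Set (EuclideanSpace ℝ (Fin m))}
    (hw : IsWeakSol u g Ω) {x₀ : EuclideanSpace ℝ (Fin m)} {R : ℝ} (hR : 0 < R)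
    (hball : Metric.closedBall x₀ (3 * R) ⊆ Ω)
    (hH : ∀ᵐ y, y ∈ Metric.ball x₀ (2 * R) → H y = g y)
    {C : ℝ} (hC : ∀ x, ‖H x‖ ≤ C) (hHi : LocallyIntegrable H) :
    ∃ w : EuclideanSpace ℝ (Fin m) → ℝ, (∀ᵐ x, x ∈ Metric.ball x₀ R → u x = w x) ∧
      Continuous w ∧ ∀ n : ℕ, ContDiff ℝ n H → HasCompactSupport H → ContDiff ℝ (n + 1) w := by
  obtain ⟨η, ψ, hη, hψ, h0, h0', hn, hn', hi, hl⟩ := exists_kernel m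
  have hU : Integrable ((Metric.closedBall x₀ (3 * R)).indicator u) :=
    (integrable_indicator_iff Metric.isClosed_closedBall.measurableSet).2
      (hw.1.integrableOn_compact_subset hball (isCompact_closedBall _ _))
  have ha : 0 < 1 / R := by positivity
  have hsm : ContDiff ℝ (⊤ : ℕ∞) (etaS η (1 / R) ⋆[lsmul ℝ ℝ, volume]
      (Metric.closedBall x₀ (3 * R)).indicator u) :=
    (hcs_of_zero (etaS_zero h0 ha)).contDiff_convolution_left _ (etaS_contDiff hη _)
      hU.locallyIntegrable
  refine ⟨fun x => (etaS η (1 / R) ⋆[lsmul ℝ ℝ, volume]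
      (Metric.closedBall x₀ (3 * R)).indicator u) x -
      ∑' j : ℕ, (psiS ψ (1 / R * 2 ^ j) ⋆[lsmul ℝ ℝ, volume] H) x, ?_, ?_, ?_⟩
  · filter_upwards [rep hη hψ h0 h0' hn hi hl hw hR hball hH] with x hx hxb
    refine tendsto_nhds_unique (hx hxb) ?_
    have := (S_summable hψ h0' ha hC x).hasSum.tendsto_sum_nat
    simp only [convolution_eq_swap] at this ⊢
    exact tendsto_const_nhds.sub this
  · exact hsm.continuous.sub (S_zero hψ h0' ha hC hHi).continuous
  · intro n hn hc
    refine ContDiff.sub (hsm.of_le ?_) (S_succ hψ h0' ha n hn hc)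
    exact_mod_cast le_top

lemma glue {u : EuclideanSpace ℝ (Fin m) → ℝ} {Ω : Set (EuclideanSpace ℝ (Fin m))}
    (h : ∀ x₀ ∈ Ω, ∃ ρ > 0, ∃ w : EuclideanSpace ℝ (Fin m) → ℝ, Continuous w ∧
      ∀ᵐ x, x ∈ Metric.ball x₀ ρ → u x = w x) :
    ∃ v : EuclideanSpace ℝ (Fin m) → ℝ, ContinuousOn v Ω ∧ ∀ᵐ x, x ∈ Ω → u x = v x := by
  choose! ρ hρ w hwc hw using h
  have key : ∀ x₀ ∈ Ω, ∀ x ∈ Ω, x ∈ Metric.ball x₀ (ρ x₀) → w x x = w x₀ x := by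
    intro x₀ h₀ x hx hxb
    have : EqOn (w x) (w x₀) (Metric.ball x₀ (ρ x₀) ∩ Metric.ball x (ρ x)) := by
      refine Measure.eqOn_open_of_ae_eq (μ := volume) ?_
        (Metric.isOpen_ball.inter Metric.isOpen_ball)
        (hwc x hx).continuousOn (hwc x₀ h₀).continuousOn
      rw [EventuallyEq, ae_restrict_iff' (Metric.isOpen_ball.inter Metric.isOpen_ball).measurableSet]
      filter_upwards [hw x hx, hw x₀ h₀] with y h1 h2 hy
      rw [← h1 hy.2, ← h2 hy.1]
    exact this ⟨hxb, Metric.mem_ball_self (hρ x hx)⟩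
  refine ⟨fun x => w x x, fun x₀ h₀ => ?_, ?_⟩
  · have := (hwc x₀ h₀).continuousWithinAt (s := Ω) (x := x₀)
    refine this.congr_of_eventuallyEq ?_ rfl
    filter_upwards [self_mem_nhdsWithin,
      mem_nhdsWithin_of_mem_nhds (Metric.ball_mem_nhds x₀ (hρ x₀ h₀))] with x hx hxb
    exact key x₀ h₀ x hx hxb
  · rw [ae_iff]
    refine measure_null_of_locally_null _ fun x₀ h₀ => ?_
    simp only [Classical.not_imp, mem_setOf_eq] at h₀
    refine ⟨{x | ¬ (x ∈ Ω → u x = w x x)} ∩ Metric.ball x₀ (ρ x₀),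
      inter_mem self_mem_nhdsWithin
        (mem_nhdsWithin_of_mem_nhds (Metric.ball_mem_nhds x₀ (hρ x₀ h₀.1))), ?_⟩
    have := hw x₀ h₀.1
    rw [ae_iff] at this
    refine measure_mono_null ?_ this
    rintro x ⟨hx, hxb⟩
    simp only [Classical.not_imp, mem_setOf_eq] at hx ⊢
    refine ⟨hxb, ?_⟩
    rw [← key x₀ h₀.1 x hx.1 hxb]
    exact hx.2

end Final

section Assembly
variable {m : ℕ}

lemma cut_contDiff {n : WithTop ℕ∞} {k χ : EuclideanSpace ℝ (Fin m) → ℝ}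
    {Ω : Set (EuclideanSpace ℝ (Fin m))} (hΩ : IsOpen Ω) (hk : ContDiffOn ℝ n k Ω)
    (hχ : ContDiff ℝ n χ) (hs : tsupport χ ⊆ Ω) : ContDiff ℝ n (fun x => χ x * k x) := by
  rw [contDiff_iff_contDiffAt]
  intro x
  by_cases hx : x ∈ tsupport χ
  · exact hχ.contDiffAt.mul (hk.contDiffAt (hΩ.mem_nhds (hs hx)))
  · have h := notMem_tsupport_iff_eventuallyEq.1 hx
    refine (contDiffAt_const (c := (0 : ℝ))).congr_of_eventuallyEq ?_
    filter_upwards [h] with y hy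
    simp [hy]

lemma exists_radius {Ω : Set (EuclideanSpace ℝ (Fin m))} (hΩ : IsOpen Ω)
    {x₀ : EuclideanSpace ℝ (Fin m)} (h₀ : x₀ ∈ Ω) :
    ∃ R > 0, Metric.closedBall x₀ (3 * R) ⊆ Ω := by
  obtain ⟨ε, hε, h⟩ := Metric.nhds_basis_closedBall.mem_iff.1 (hΩ.mem_nhds h₀)
  exact ⟨ε / 3, by positivity, by rwa [mul_div_cancel₀ _ (by norm_num : (3 : ℝ) ≠ 0)]⟩

lemma loc_cont {Ω : Set (EuclideanSpace ℝ (Fin m))} (hΩo : IsOpen Ω)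
    {f : EuclideanSpace ℝ (Fin m) × ℝ → ℝ} (hf : ContDiff ℝ (⊤ : ℕ∞) f)
    (hfnonneg : ∀ q, 0 ≤ f q)
    (hfmono : ∀ x : EuclideanSpace ℝ (Fin m), ∀ s : ℝ, 0 ≤ deriv (fun r => f (x, r)) s)
    {u : EuclideanSpace ℝ (Fin m) → ℝ}
    (hw : IsWeakSol u (fun x => f (x, u x)) Ω) :
    ∀ x₀ ∈ Ω, ∃ ρ > 0, ∃ w : EuclideanSpace ℝ (Fin m) → ℝ, Continuous w ∧
      ∀ᵐ x, x ∈ Metric.ball x₀ ρ → u x = w x := by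
  intro x₀ h₀
  obtain ⟨R, hR, hball⟩ := exists_radius hΩo h₀
  obtain ⟨C, hC⟩ := upper_bound hw (fun x => hfnonneg _) hR hball
  have hmono : ∀ x, Monotone fun r => f (x, r) := fun x =>
    monotone_of_deriv_nonneg ((hf.comp (contDiff_const.prodMk contDiff_id)).differentiable
      (by simp)) (hfmono x)
  have hcf : Continuous fun x => f (x, C) := hf.continuous.comp (by fun_prop)
  obtain ⟨M, hM⟩ := (isCompact_closedBall x₀ R).exists_bound_of_continuousOn hcf.continuousOn
  have hM0 : 0 ≤ M := (norm_nonneg _).trans (hM x₀ (Metric.mem_closedBall_self hR.le))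
  set H := (Metric.ball x₀ R).indicator (fun x => min (f (x, u x)) M) with hH
  have hsub : Metric.closedBall x₀ R ⊆ Ω :=
    (Metric.closedBall_subset_closedBall (by linarith)).trans hball
  have hHb : ∀ x, ‖H x‖ ≤ M := by
    intro x
    by_cases hx : x ∈ Metric.ball x₀ R
    · rw [hH, Set.indicator_of_mem hx, Real.norm_of_nonneg (le_min (hfnonneg _) hM0)]
      exact min_le_right _ _
    · rw [hH, Set.indicator_of_notMem hx]
      simpa using hM0
  have hHi : Integrable H := by
    refine (integrable_indicator_iff measurableSet_ball).2 ?_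
    have h1 : IntegrableOn (fun x => f (x, u x)) (Metric.ball x₀ R) :=
      (hw.2.1.integrableOn_compact_subset hsub (isCompact_closedBall _ _)).mono_set
        Metric.ball_subset_closedBall
    have h2 : IntegrableOn (fun _ : EuclideanSpace ℝ (Fin m) => M) (Metric.ball x₀ R) :=
      integrableOn_const measure_ball_lt_top.ne
    exact Integrable.inf h1 h2
  have hR3 : 0 < R / 3 := by positivity
  have hae : ∀ᵐ y, y ∈ Metric.ball x₀ (2 * (R / 3)) → H y = f (y, u y) := by
    filter_upwards [hC] with y hy hyb
    have hyR : y ∈ Metric.ball x₀ R := Metric.ball_subset_ball (by linarith) hyb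
    rw [hH, Set.indicator_of_mem hyR]
    refine min_eq_left ((hmono y (hy hyR)).trans ?_)
    exact (Real.le_norm_self _).trans (hM y (Metric.ball_subset_closedBall hyR))
  obtain ⟨w, hw1, hw2, -⟩ := local_rep hw (x₀ := x₀) (R := R / 3) (H := H) hR3
    (by rwa [mul_div_cancel₀ _ (by norm_num : (3 : ℝ) ≠ 0)]) hae hHb hHi.locallyIntegrable
  exact ⟨R / 3, hR3, w, hw2, hw1⟩

lemma weak_congr {Ω : Set (EuclideanSpace ℝ (Fin m))} (hΩo : IsOpen Ω)
    {f : EuclideanSpace ℝ (Fin m) × ℝ → ℝ} (hf : ContDiff ℝ (⊤ : ℕ∞) f)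
    {u v : EuclideanSpace ℝ (Fin m) → ℝ}
    (hw : IsWeakSol u (fun x => f (x, u x)) Ω) (hv : ContinuousOn v Ω)
    (huv : ∀ᵐ x, x ∈ Ω → u x = v x) : IsWeakSol v (fun x => f (x, v x)) Ω := by
  refine ⟨hv.locallyIntegrableOn hΩo.measurableSet,
    ContinuousOn.locallyIntegrableOn (hf.continuous.comp_continuousOn
      (continuousOn_id.prodMk hv)) hΩo.measurableSet, fun φ h1 h2 h3 => ?_⟩
  have e1 : ∫ x in Ω, v x * lap φ x = ∫ x in Ω, u x * lap φ x := by
    refine setIntegral_congr_ae hΩo.measurableSet ?_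
    filter_upwards [huv] with x hx hxΩ
    rw [hx hxΩ]
  have e2 : ∫ x in Ω, f (x, v x) * φ x = ∫ x in Ω, f (x, u x) * φ x := by
    refine setIntegral_congr_ae hΩo.measurableSet ?_
    filter_upwards [huv] with x hx hxΩ
    rw [hx hxΩ]
  rw [e1, e2]
  exact hw.2.2 φ h1 h2 h3

lemma boot {Ω : Set (EuclideanSpace ℝ (Fin m))} (hΩo : IsOpen Ω)
    {f : EuclideanSpace ℝ (Fin m) × ℝ → ℝ} (hf : ContDiff ℝ (⊤ : ℕ∞) f)
    {v : EuclideanSpace ℝ (Fin m) → ℝ}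
    (hw : IsWeakSol v (fun x => f (x, v x)) Ω) (hv : ContinuousOn v Ω) :
    ∀ n : ℕ, ContDiffOn ℝ n v Ω := by
  intro n
  induction n with
  | zero => simpa using hv
  | succ n ih =>
    intro x₀ h₀
    refine ContDiffAt.contDiffWithinAt ?_
    obtain ⟨R, hR, hball⟩ := exists_radius hΩo h₀
    let χ : ContDiffBump x₀ := ⟨2 * R, 3 * R, by positivity, by linarith⟩
    have hs : tsupport χ ⊆ Ω := by rw [χ.tsupport_eq]; exact hball
    have hg : ContDiffOn ℝ n (fun x => f (x, v x)) Ω :=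
      (hf.of_le (by exact_mod_cast le_top)).comp_contDiffOn (contDiffOn_id.prodMk ih)
    have hH : ContDiff ℝ n (fun x => χ x * f (x, v x)) :=
      cut_contDiff hΩo hg χ.contDiff hs
    have hHc : HasCompactSupport (fun x => χ x * f (x, v x)) := χ.hasCompactSupport.mul_right
    obtain ⟨C, hC⟩ := hHc.exists_bound_of_continuous hH.continuous
    obtain ⟨w, hw1, hw2, hw3⟩ := local_rep hw (x₀ := x₀) hR hball
      (H := fun x => χ x * f (x, v x)) (Eventually.of_forall fun y hy => by
        have : χ y = 1 := χ.one_of_mem_closedBall (Metric.ball_subset_closedBall hy)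
        simp [this]) hC hH.continuous.locallyIntegrable
    have hbΩ : Metric.ball x₀ R ⊆ Ω := Metric.ball_subset_closedBall.trans
      ((Metric.closedBall_subset_closedBall (by linarith)).trans hball)
    have heq : EqOn v w (Metric.ball x₀ R) :=
      Measure.eqOn_open_of_ae_eq (μ := volume)
        ((ae_restrict_iff' measurableSet_ball).2 hw1) Metric.isOpen_ball
        (hv.mono hbΩ) hw2.continuousOn
    have := (hw3 n hH hHc).contDiffAt (x := x₀)
    push_cast
    exact this.congr_of_eventuallyEq
      (heq.eventuallyEq_of_mem (Metric.ball_mem_nhds _ hR))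

lemma lap_congr {v w : EuclideanSpace ℝ (Fin m) → ℝ} {x : EuclideanSpace ℝ (Fin m)}
    (h : v =ᶠ[𝓝 x] w) : lap v x = lap w x := by
  simp only [lap, h.fderiv.fderiv_eq]

lemma lap_cont {w : EuclideanSpace ℝ (Fin m) → ℝ} (hw : ContDiff ℝ (⊤ : ℕ∞) w) :
    Continuous (lap w) := by
  have h1 := hw.fderiv_right (m := (⊤ : ℕ∞)) (by simp)
  have h2 := h1.fderiv_right (m := (⊤ : ℕ∞)) (by simp)
  refine continuous_finsetSum _ fun i _ => ?_
  exact (h2.continuous.clm_apply continuous_const).clm_apply continuous_const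

lemma classical {Ω : Set (EuclideanSpace ℝ (Fin m))} (hΩo : IsOpen Ω)
    {g v : EuclideanSpace ℝ (Fin m) → ℝ}
    (hw : IsWeakSol v g Ω) (hg : ContinuousOn g Ω) (hv : ContDiffOn ℝ (⊤ : ℕ∞) v Ω) :
    ∀ x ∈ Ω, lap v x = g x := by
  intro x₀ h₀
  obtain ⟨R, hR, hball⟩ := exists_radius hΩo h₀
  let χ : ContDiffBump x₀ := ⟨2 * R, 3 * R, by positivity, by linarith⟩
  have hs : tsupport χ ⊆ Ω := by rw [χ.tsupport_eq]; exact hball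
  set w : EuclideanSpace ℝ (Fin m) → ℝ := fun x => χ x * v x with hwdef
  have hwc : ContDiff ℝ (⊤ : ℕ∞) w := cut_contDiff hΩo hv χ.contDiff hs
  have hbΩ : Metric.ball x₀ R ⊆ Ω := Metric.ball_subset_closedBall.trans
    ((Metric.closedBall_subset_closedBall (by linarith)).trans hball)
  have heq : EqOn v w (Metric.ball x₀ R) := fun y hy => by
    have : χ y = 1 := χ.one_of_mem_closedBall
      ((Metric.ball_subset_ball (by linarith)).trans Metric.ball_subset_closedBall hy)
    simp [hwdef, this]
  have hlc := lap_cont hwc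
  have hcont : ContinuousOn (fun x => lap w x - g x) (Metric.ball x₀ R) :=
    hlc.continuousOn.sub (hg.mono hbΩ)
  have hae : ∀ᵐ x, x ∈ Metric.ball x₀ R → lap w x - g x = 0 := by
    refine Metric.isOpen_ball.ae_eq_zero_of_integral_contDiff_smul_eq_zero
      (hcont.locallyIntegrableOn measurableSet_ball) fun φ h1 h2 h3 => ?_
    have hφ0 : ∀ x, x ∉ Metric.ball x₀ R → φ x = 0 := fun x hx =>
      image_eq_zero_of_notMem_tsupport fun h => hx (h3 h)
    have hl0 : ∀ x, x ∉ Metric.ball x₀ R → lap φ x = 0 := fun x hx => by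
      have h := notMem_tsupport_iff_eventuallyEq.1 fun h => hx (h3 h)
      rw [lap_congr h]
      have hz : fderiv ℝ (0 : EuclideanSpace ℝ (Fin m) → ℝ) = 0 := by
        funext y; simp
      have hz' : fderiv ℝ (0 : EuclideanSpace ℝ (Fin m) → EuclideanSpace ℝ (Fin m) →L[ℝ] ℝ) = 0 := by
        funext y; simp
      simp [lap, hz, hz']
    have e := hw.2.2 φ h1 h2 (h3.trans hbΩ)
    rw [setIntegral_eq_integral_of_forall_compl_eq_zero (fun x hx => by
      rw [hl0 x fun h => hx (hbΩ h), mul_zero]), setIntegral_eq_integral_of_forall_compl_eq_zero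
      (fun x hx => by rw [hφ0 x fun h => hx (hbΩ h), mul_zero])] at e
    have e2 : ∫ x, v x * lap φ x = ∫ x, w x * lap φ x := by
      refine integral_congr_ae (Eventually.of_forall fun x => ?_)
      by_cases hx : x ∈ Metric.ball x₀ R
      · simp only [heq hx]
      · simp only [hl0 x hx, mul_zero]
    rw [e2, lap_symm hwc h1 h2] at e
    have i1 : Integrable fun x => lap w x * φ x :=
      (hlc.mul h1.continuous).integrable_of_hasCompactSupport h2.mul_left
    have hgφ : Continuous fun x => φ x * g x := by
      have := cut_contDiff (n := 0) (hΩo) (contDiffOn_zero.2 hg)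
        (h1.of_le (by simp)) (h3.trans hbΩ)
      exact this.continuous
    have i2 : Integrable fun x => g x * φ x := by
      have := hgφ.integrable_of_hasCompactSupport (μ := volume) h2.mul_right
      simpa [mul_comm] using this
    have : (fun x => φ x • (lap w x - g x)) = fun x => lap w x * φ x - g x * φ x := by
      funext x; simp only [smul_eq_mul]; ring
    rw [this, integral_sub i1 i2, e, sub_self]
  have hE : EqOn (fun x => lap w x - g x) (fun _ => 0) (Metric.ball x₀ R) :=
    Measure.eqOn_open_of_ae_eq (μ := volume)
      ((ae_restrict_iff' measurableSet_ball).2 hae) Metric.isOpen_ball hcont continuousOn_const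
  have := hE (Metric.mem_ball_self hR)
  rw [lap_congr (heq.eventuallyEq_of_mem (Metric.ball_mem_nhds _ hR))]
  exact sub_eq_zero.1 this

end Assembly

end Helpers

/-- regularity: if `u` is a weak solution of `Δu = f(·,u)` on a
domain `Ω` with `f ≥ 0` smooth and `∂f/∂u ≥ 0`, then `u` agrees a.e. with a smooth
function on `Ω`, which solves `Δu = f(·,u)` classically. -/
theorem stmt18 {m : ℕ}
    (Ω : Set (EuclideanSpace ℝ (Fin m))) (hΩo : IsOpen Ω) (hΩc : IsConnected Ω)
    (f : EuclideanSpace ℝ (Fin m) × ℝ → ℝ) (hf : ContDiff ℝ (⊤ : ℕ∞) f)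
    (hfnonneg : ∀ q, 0 ≤ f q)
    (hfmono : ∀ x : EuclideanSpace ℝ (Fin m), ∀ s : ℝ, 0 ≤ deriv (fun r => f (x, r)) s)
    (u : EuclideanSpace ℝ (Fin m) → ℝ)
    (hweak : IsWeakSol u (fun x => f (x, u x)) Ω) :
    ∃ v : EuclideanSpace ℝ (Fin m) → ℝ, ContDiffOn ℝ (⊤ : ℕ∞) v Ω ∧
      (∀ᵐ x ∂(volume.restrict Ω), u x = v x) ∧
      ∀ x ∈ Ω, lap v x = f (x, v x) := by
  obtain ⟨v, hv, huv⟩ := glue (loc_cont hΩo hf hfnonneg hfmono hweak)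
  have hw := weak_congr hΩo hf hweak hv huv
  have hsm : ContDiffOn ℝ (⊤ : ℕ∞) v Ω := contDiffOn_infty.2 (boot hΩo hf hw hv)
  exact ⟨v, hsm, (ae_restrict_iff' hΩo.measurableSet).2 huv,
    classical hΩo hw (hf.continuous.comp_continuousOn (continuousOn_id.prodMk hv)) hsm⟩
end
end
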